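/- arXiv:1311.3651 — 3 statements merged into one kernel-verified Lean document; each statement's English description precedes it below -/
import Mathlib

section
/- For any constant δ ∈ (0,1), given any subspace 𝒱 of dimension δ·n^ℓ in ℝ^{n^ℓ} (viewed as order-ℓ tensors), there exist tensors T_1, T_2, ..., T_r in 𝒱 of unit Frobenius norm such that for ρ-perturbations x̃^(1), x̃^(2), ..., x̃^(ℓ) ∈ ℝ^n of any vectors x^(1), x^(2), ..., x^(ℓ) ∈ ℝ^n, with probability at least 1 − exp(−δ n^{1/(2ℓ)^ℓ}) there exists j ∈ [r] such that |T_j(x̃^(1), x̃^(2), ..., x̃^(ℓ))| ≥ ρ^ℓ (1/n)^{3^ℓ}. -/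
open MeasureTheory ProbabilityTheory

noncomputable section

/-- Euclidean (Frobenius) norm of a vector indexed by a finite type. -/
def enorm2 {ι : Type*} [Fintype ι] (x : ι → ℝ) : ℝ :=
  Real.sqrt (∑ i, x i ^ 2)

/-- The law of a ρ-perturbation noise vector in ℝⁿ: independent Gaussian coordinates of
mean 0 and variance ρ²/n. -/
def gaussianVec (n : ℕ) (ρ : ℝ) : Measure (Fin n → ℝ) :=
  Measure.pi fun _ => gaussianReal 0 (Real.toNNReal (ρ ^ 2 / n))

/-- Auerbach-type lemma: a compact set enlarged by a ball contains a basis whose dual system is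
bounded by one on the enlarged set. -/
theorem exists_dual_system_of_isCompact {n : ℕ} (K : Set (EuclideanSpace ℝ (Fin n)))
    (hK : IsCompact K) {η : ℝ} (hη : 0 < η) :
    ∃ v c : Fin n → EuclideanSpace ℝ (Fin n),
      (∀ j, v j ∈ K ∪ Metric.closedBall 0 η) ∧
      (∀ i j, inner ℝ (c i) (v j) = if i = j then 1 else 0) ∧
      ∀ j, ∀ b ∈ K ∪ Metric.closedBall 0 η, |inner ℝ (c j) b| ≤ 1 := by
  set B := (EuclideanSpace.basisFun (Fin n) ℝ).toBasis with hB
  set S := K ∪ Metric.closedBall (0 : EuclideanSpace ℝ (Fin n)) η with hS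
  have hSc : IsCompact S := hK.union (isCompact_closedBall 0 η)
  have hcont : Continuous fun v : Fin n → EuclideanSpace ℝ (Fin n) => |B.det v| := by
    simp_rw [Module.Basis.det_apply]
    refine (Continuous.matrix_det ?_).abs
    refine continuous_matrix fun i j => ?_
    simp only [Module.Basis.toMatrix_apply, hB, OrthonormalBasis.coe_toBasis_repr_apply,
      EuclideanSpace.basisFun_repr]
    fun_prop
  have hball : ∀ j, η • B j ∈ S := by
    intro j
    right
    simp [hB, norm_smul, abs_of_pos hη]
  obtain ⟨v, hv, hmax⟩ := (isCompact_univ_pi fun _ : Fin n => hSc).exists_isMaxOn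
    ⟨fun j => η • B j, fun j _ => hball j⟩ hcont.continuousOn
  have hmax' : ∀ w : Fin n → EuclideanSpace ℝ (Fin n), (∀ j, w j ∈ S) →
      |B.det w| ≤ |B.det v| := fun w hw => hmax fun j _ => hw j
  have hv' : ∀ j, v j ∈ S := fun j => hv j trivial
  have hpos : 0 < |B.det v| := by
    refine lt_of_lt_of_le ?_ (hmax' _ hball)
    have h := B.det.map_smul_univ (fun _ => η) B
    rw [h]
    simp [hη.ne', Module.Basis.det_self]
  have hne : B.det v ≠ 0 := abs_pos.mp hpos
  let φ : Fin n → EuclideanSpace ℝ (Fin n) →ₗ[ℝ] ℝ := fun j =>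
    (B.det v)⁻¹ • B.det.toMultilinearMap.toLinearMap v j
  have hφ : ∀ j x, φ j x = (B.det v)⁻¹ * B.det (Function.update v j x) := fun j x => rfl
  refine ⟨v, fun j => (InnerProductSpace.toDual ℝ _).symm (φ j).toContinuousLinearMap, hv', ?_, ?_⟩
  · intro i j
    simp only [InnerProductSpace.toDual_symm_apply, LinearMap.coe_toContinuousLinearMap', hφ]
    split_ifs with h
    · subst h
      simp [hne]
    · rw [B.det.map_update_self v h, mul_zero]
  · intro j b hb
    simp only [InnerProductSpace.toDual_symm_apply, LinearMap.coe_toContinuousLinearMap', hφ]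
    rw [abs_mul, abs_inv, inv_mul_le_iff₀ hpos, mul_one]
    refine hmax' _ fun i => ?_
    by_cases h : i = j
    · subst h; simpa using hb
    · simpa [h] using hv' i

theorem norm_le_inv_of_abs_inner_le_one {E : Type*} [NormedAddCommGroup E] [InnerProductSpace ℝ E]
    {η : ℝ} (hη : 0 < η) {c : E}
    (hc : ∀ b ∈ Metric.closedBall (0 : E) η, |inner ℝ c b| ≤ 1) : ‖c‖ ≤ η⁻¹ := by
  by_cases h0 : c = 0
  · simp [h0, hη.le]
  have hp : 0 < ‖c‖ := norm_pos_iff.mpr h0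
  have := hc ((η / ‖c‖) • c) (by simp [norm_smul, abs_of_pos hη, hp.ne'])
  rw [inner_smul_right, real_inner_self_eq_norm_sq, abs_of_nonneg (by positivity)] at this
  rw [← one_div, le_div_iff₀ hη]
  field_simp at this
  linarith

theorem eq_smul_of_inner_eq_one {E : Type*} [NormedAddCommGroup E] [InnerProductSpace ℝ E]
    {η : ℝ} (hη : 0 < η) {c v : E} (hc : ‖c‖ ≤ η⁻¹) (hv : ‖v‖ ≤ η) (h : inner ℝ c v = 1) :
    v = η ^ 2 • c := by
  rw [← sub_eq_zero, ← norm_eq_zero, ← sq_eq_zero_iff]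
  refine le_antisymm ?_ (by positivity)
  rw [norm_sub_sq_real, inner_smul_right, real_inner_comm, h, norm_smul]
  have h1 : ‖v‖ ^ 2 ≤ η ^ 2 := by gcongr
  have h2 : ‖c‖ * η ≤ 1 := by
    calc ‖c‖ * η ≤ η⁻¹ * η := by gcongr
      _ = 1 := inv_mul_cancel₀ hη.ne'
  have h3 : (‖c‖ * η) ^ 2 ≤ 1 := pow_le_one₀ (by positivity) h2
  simp only [Real.norm_eq_abs, abs_of_pos (pow_pos hη 2)]
  nlinarith [mul_le_mul_of_nonneg_left h3 (sq_nonneg η)]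

/-- A linear map `A` is `σ`-small on the span of some orthonormal `p`-frame. -/
def SmallOnFrame {D F : Type*} [NormedAddCommGroup D] [InnerProductSpace ℝ D]
    [NormedAddCommGroup F] [InnerProductSpace ℝ F] (p : ℕ) (σ : ℝ) (A : D →ₗ[ℝ] F) : Prop :=
  ∃ f : Fin p → D, Orthonormal ℝ f ∧
    ∀ a : Fin p → ℝ, ‖A (∑ i, a i • f i)‖ ^ 2 ≤ σ ^ 2 * ∑ i, a i ^ 2

theorem SmallOnFrame.exists_submodule {D F : Type*} [NormedAddCommGroup D] [InnerProductSpace ℝ D]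
    [NormedAddCommGroup F] [InnerProductSpace ℝ F]
    {p : ℕ} {σ : ℝ} {A : D →ₗ[ℝ] F} (h : SmallOnFrame p σ A) :
    ∃ L : Submodule ℝ D, Module.finrank ℝ L = p ∧ ∀ a ∈ L, ‖A a‖ ^ 2 ≤ σ ^ 2 * ‖a‖ ^ 2 := by
  obtain ⟨f, hf, h⟩ := h
  refine ⟨Submodule.span ℝ (Set.range f), ?_, ?_⟩
  · simpa using finrank_span_eq_card hf.linearIndependent
  · intro a ha
    obtain ⟨c, rfl⟩ := (Submodule.mem_span_range_iff_exists_fun ℝ).mp ha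
    have : ‖∑ i, c i • f i‖ ^ 2 = ∑ i, c i ^ 2 := by
      rw [← real_inner_self_eq_norm_sq, hf.inner_sum]
      simp [sq]
    rw [this]
    exact h c

theorem isCompact_smallOnFrame {D F : Type*} [NormedAddCommGroup D] [InnerProductSpace ℝ D]
    [FiniteDimensional ℝ D] [NormedAddCommGroup F] [InnerProductSpace ℝ F]
    {n : ℕ} (M : EuclideanSpace ℝ (Fin n) →ₗ[ℝ] D →ₗ[ℝ] F)
    (hM : Continuous fun q : EuclideanSpace ℝ (Fin n) × D => M q.1 q.2) (p : ℕ) (σ R : ℝ) :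
    IsCompact {x | SmallOnFrame p σ (M x) ∧ ‖x‖ ≤ R} := by
  let S : Set (EuclideanSpace ℝ (Fin n) × (Fin p → D)) :=
    {q | Orthonormal ℝ q.2 ∧
      ∀ a : Fin p → ℝ, ‖M q.1 (∑ i, a i • q.2 i)‖ ^ 2 ≤ σ ^ 2 * ∑ i, a i ^ 2}
  have hS : IsClosed S := by
    simp only [S, Set.ofPred_and]
    refine IsClosed.inter ?_ ?_
    · simp only [orthonormal_iff_ite]
      simp only [Set.ofPred_forall]
      refine isClosed_iInter fun i => isClosed_iInter fun j => isClosed_eq ?_ continuous_const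
      fun_prop
    · simp only [Set.ofPred_forall]
      refine isClosed_iInter fun a => isClosed_le ?_ continuous_const
      have : Continuous fun q : EuclideanSpace ℝ (Fin n) × (Fin p → D) =>
          (q.1, ∑ i, a i • q.2 i) := by fun_prop
      exact ((hM.comp this).norm.pow 2)
  have hc := ((isCompact_closedBall (0 : EuclideanSpace ℝ (Fin n)) R).prod
    (isCompact_closedBall (0 : Fin p → D) 1)).inter_right hS
  have key : {x | SmallOnFrame p σ (M x) ∧ ‖x‖ ≤ R} =
      Set.image Prod.fst (Metric.closedBall 0 R ×ˢ Metric.closedBall 0 1 ∩ S) := ?_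
  · rw [key]
    exact hc.image continuous_fst
  refine Set.ext fun x => ⟨?_, ?_⟩
  · rintro ⟨⟨f, hf, h⟩, hx⟩
    refine ⟨(x, f), ⟨⟨by simpa using hx, ?_⟩, hf, h⟩, rfl⟩
    simp only [mem_closedBall_zero_iff]
    exact (pi_norm_le_iff_of_nonneg zero_le_one).mpr fun i => (hf.1 i).le
  · rintro ⟨⟨x', f⟩, ⟨⟨hx, -⟩, hf, h⟩, rfl⟩
    exact ⟨⟨f, hf, h⟩, by simpa using hx⟩

/-- If `A = M (v j)` is small on a large frame for all `j` outside `J`, where `v` has a bounded dual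
system, then the domain cannot be too large. -/
theorem finrank_le_of_smallOnFrame {D F : Type*} [NormedAddCommGroup D] [InnerProductSpace ℝ D]
    [FiniteDimensional ℝ D] [NormedAddCommGroup F] [InnerProductSpace ℝ F] [FiniteDimensional ℝ F]
    {n p κ : ℕ}
    (M : EuclideanSpace ℝ (Fin n) →ₗ[ℝ] D →ₗ[ℝ] F)
    (hHS : ∀ a, ∑ i, ‖M (EuclideanSpace.single i 1) a‖ ^ 2 = ‖a‖ ^ 2)
    {σ η : ℝ} (hσ : 0 ≤ σ) (hση : n * σ < η) (hp : p + κ = Module.finrank ℝ D)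
    (v c : Fin n → EuclideanSpace ℝ (Fin n))
    (hvc : ∀ i j, inner ℝ (c i) (v j) = if i = j then 1 else 0)
    (hc : ∀ j, ‖c j‖ ≤ η⁻¹) (J : Finset (Fin n))
    (hJ : ∀ j ∉ J, SmallOnFrame p σ (M (v j))) :
    Module.finrank ℝ D ≤ (n - J.card) * κ + J.card * Module.finrank ℝ F := by
  have hη : 0 < η := lt_of_le_of_lt (by positivity) hση
  by_contra! hlt
  choose! L hLp hL using fun (j : {j // j ∉ J}) => (hJ j j.2).exists_submodule
  let Φ : D →ₗ[ℝ] (∀ j : {j // j ∉ J}, D ⧸ L j) × (J → F) :=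
    (LinearMap.pi fun j => (L j).mkQ).prod (LinearMap.pi fun j => M (v j))
  have hκ : ∀ j, Module.finrank ℝ (D ⧸ L j) = κ := by
    intro j
    have := (L j).finrank_quotient_add_finrank
    have := hLp j
    omega
  have hrank : Module.finrank ℝ ((∀ j : {j // j ∉ J}, D ⧸ L j) × (J → F)) < Module.finrank ℝ D := by
    rw [Module.finrank_prod, Module.finrank_pi_fintype, Module.finrank_pi_fintype]
    simp only [hκ]
    simpa [Fintype.card_subtype_compl] using hlt
  obtain ⟨a, haΦ, ha0⟩ := (Submodule.ne_bot_iff _).mp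
    (LinearMap.ker_ne_bot_of_finrank_lt (f := Φ) hrank)
  rw [LinearMap.mem_ker, Prod.ext_iff] at haΦ
  obtain ⟨h1, h2⟩ := haΦ
  have h1' : ∀ j (hj : j ∉ J), ‖M (v j) a‖ ≤ σ * ‖a‖ := by
    intro j hj
    have : a ∈ L ⟨j, hj⟩ := (Submodule.Quotient.mk_eq_zero _).mp
      (congrFun (h1 : (fun j => (L j).mkQ a) = 0) ⟨j, hj⟩)
    refine le_of_sq_le_sq ?_ (by positivity)
    rw [mul_pow]
    exact hL ⟨j, hj⟩ a this
  have h2' : ∀ j ∈ J, M (v j) a = 0 := fun j hj =>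
    congrFun (h2 : (fun j : J => M (v j) a) = 0) ⟨j, hj⟩
  have h3 : ∀ j, ‖M (v j) a‖ ≤ σ * ‖a‖ := by
    intro j
    by_cases hj : j ∈ J
    · rw [h2' j hj, norm_zero]; positivity
    · exact h1' j hj
  have hli : LinearIndependent ℝ v := by
    rw [Fintype.linearIndependent_iff]
    intro g hg i
    have := congrArg (inner ℝ (c i)) hg
    simpa [inner_sum, inner_smul_right, hvc] using this
  have hexp : ∀ x : EuclideanSpace ℝ (Fin n), x = ∑ j, inner ℝ (c j) x • v j := by
    intro x
    have hx : x ∈ Submodule.span ℝ (Set.range v) := by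
      rw [hli.span_eq_top_of_card_eq_finrank' (by simp)]
      trivial
    obtain ⟨g, rfl⟩ := (Submodule.mem_span_range_iff_exists_fun ℝ).mp hx
    simp [inner_sum, inner_smul_right, hvc]
  have h4 : ∀ i, ‖M (EuclideanSpace.single i 1) a‖ ^ 2 ≤
      n * (∑ j, (c j i) ^ 2) * (σ * ‖a‖) ^ 2 := by
    intro i
    have e : M (EuclideanSpace.single i 1) a = ∑ j, c j i • M (v j) a := by
      conv_lhs => rw [hexp (EuclideanSpace.single i 1)]
      simp [EuclideanSpace.inner_single_right]
    have h5 : ‖M (EuclideanSpace.single i 1) a‖ ≤ (∑ j, |c j i|) * (σ * ‖a‖) := by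
      rw [e, Finset.sum_mul]
      refine (norm_sum_le _ _).trans (Finset.sum_le_sum fun j _ => ?_)
      rw [norm_smul, Real.norm_eq_abs]
      exact mul_le_mul_of_nonneg_left (h3 j) (abs_nonneg _)
    calc ‖M (EuclideanSpace.single i 1) a‖ ^ 2 ≤ ((∑ j, |c j i|) * (σ * ‖a‖)) ^ 2 := by gcongr
      _ = (∑ j, |c j i|) ^ 2 * (σ * ‖a‖) ^ 2 := mul_pow _ _ _
      _ ≤ _ := by
        gcongr
        simpa using sq_sum_le_card_mul_sum_sq (s := Finset.univ) (f := fun j => |c j i|)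
  have h6 : ∑ i, ∑ j, (c j i) ^ 2 ≤ n * (η⁻¹) ^ 2 := by
    rw [Finset.sum_comm]
    have : ∀ j, ∑ i, (c j i) ^ 2 ≤ (η⁻¹) ^ 2 := by
      intro j
      rw [← EuclideanSpace.real_norm_sq_eq]
      gcongr
      exact hc j
    calc _ ≤ ∑ j : Fin n, (η⁻¹) ^ 2 := Finset.sum_le_sum fun j _ => this j
      _ = _ := by simp
  have h7 : ‖a‖ ^ 2 ≤ (n * σ * η⁻¹) ^ 2 * ‖a‖ ^ 2 := by
    calc ‖a‖ ^ 2 = ∑ i, ‖M (EuclideanSpace.single i 1) a‖ ^ 2 := (hHS a).symm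
      _ ≤ ∑ i, n * (∑ j, (c j i) ^ 2) * (σ * ‖a‖) ^ 2 := Finset.sum_le_sum fun i _ => h4 i
      _ = n * (∑ i, ∑ j, (c j i) ^ 2) * (σ * ‖a‖) ^ 2 := by
        rw [Finset.mul_sum, Finset.sum_mul]
      _ ≤ n * (n * (η⁻¹) ^ 2) * (σ * ‖a‖) ^ 2 := by gcongr
      _ = _ := by ring
  have h8 : n * σ * η⁻¹ < 1 := by
    rw [← div_eq_mul_inv, div_lt_one hη]
    exact hση
  have h9 : (n * σ * η⁻¹) ^ 2 < 1 := pow_lt_one₀ (by positivity) h8 (by norm_num)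
  have : 0 < ‖a‖ ^ 2 := by
    have := norm_pos_iff.mpr ha0
    positivity
  nlinarith

theorem exists_singular_basis {D F : Type*} [NormedAddCommGroup D] [InnerProductSpace ℝ D]
    [FiniteDimensional ℝ D] [NormedAddCommGroup F] [InnerProductSpace ℝ F] [FiniteDimensional ℝ F]
    {d : ℕ} (hd : Module.finrank ℝ D = d) (A : D →ₗ[ℝ] F) :
    ∃ (B : OrthonormalBasis (Fin d) ℝ D) (s : Fin d → ℝ),
      ∀ i j, inner ℝ (A (B i)) (A (B j)) = if i = j then s i else 0 := by
  have hT : (LinearMap.adjoint A ∘ₗ A).IsSymmetric := by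
    intro x y
    simp [LinearMap.adjoint_inner_left, LinearMap.adjoint_inner_right]
  refine ⟨hT.eigenvectorBasis hd, hT.eigenvalues hd, fun i j => ?_⟩
  rw [← LinearMap.adjoint_inner_left, ← LinearMap.comp_apply, hT.apply_eigenvectorBasis,
    inner_smul_left, OrthonormalBasis.inner_eq_ite]
  simp

theorem exists_singular_basis_of_not_smallOnFrame {D F : Type*} [NormedAddCommGroup D]
    [InnerProductSpace ℝ D] [FiniteDimensional ℝ D] [NormedAddCommGroup F]
    [InnerProductSpace ℝ F] [FiniteDimensional ℝ F]
    {d p κ : ℕ} (hd : Module.finrank ℝ D = d)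
    (hp : p + κ = d) {σ : ℝ} {A : D →ₗ[ℝ] F} (hA : ¬ SmallOnFrame p σ A) :
    ∃ (B : OrthonormalBasis (Fin d) ℝ D) (s : Fin d → ℝ) (e : Fin (κ + 1) ↪ Fin d),
      (∀ i j, inner ℝ (A (B i)) (A (B j)) = if i = j then s i else 0) ∧
      ∀ i, σ ^ 2 < s (e i) := by
  obtain ⟨B, s, h⟩ := exists_singular_basis hd A
  have hcard : κ + 1 ≤ (Finset.univ.filter fun i => σ ^ 2 < s i).card := by
    by_contra! hlt
    apply hA
    have h1 : p ≤ (Finset.univ.filter fun i => s i ≤ σ ^ 2).card := by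
      have := Finset.card_filter_add_card_filter_not (s := Finset.univ) (fun i => σ ^ 2 < s i)
      simp only [not_lt, Finset.card_univ, Fintype.card_fin] at this
      omega
    obtain ⟨t, ht, htc⟩ := Finset.exists_subset_card_eq h1
    let e := t.orderEmbOfFin htc
    have he : ∀ i, s (e i) ≤ σ ^ 2 := fun i => by
      simpa using ht (t.orderEmbOfFin_mem htc i)
    refine ⟨fun i => B (e i), B.orthonormal.comp _ e.injective, fun a => ?_⟩
    rw [← real_inner_self_eq_norm_sq, Finset.mul_sum]
    simp only [map_sum, map_smul, sum_inner, inner_sum, inner_smul_left, inner_smul_right, h,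
      e.injective.eq_iff]
    refine Finset.sum_le_sum fun i _ => ?_
    simp only [mul_ite, mul_zero, Finset.sum_ite_eq, Finset.mem_univ, if_true, eq_comm]
    have := mul_le_mul_of_nonneg_right (he i) (sq_nonneg (a i))
    simp
    nlinarith
  obtain ⟨t, ht, htc⟩ := Finset.exists_subset_card_eq hcard
  refine ⟨B, s, (t.orderEmbOfFin htc).toEmbedding, h, fun i => ?_⟩
  simpa using ht (t.orderEmbOfFin_mem htc i)

theorem gaussianReal_abs_add_mul_le (a : ℝ) {s η : ℝ} (hs : 0 < s) :
    gaussianReal 0 1 {t | |a + s * t| ≤ η} ≤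
      ENNReal.ofReal (2 * η / (s * √(2 * Real.pi))) := by
  have hset : {t | |a + s * t| ≤ η} = Set.Icc ((-η - a) / s) ((η - a) / s) := by
    refine Set.ext fun t => ?_
    simp only [Set.mem_Icc, div_le_iff₀ hs, le_div_iff₀ hs]
    change |a + s * t| ≤ η ↔ _
    rw [abs_le]
    constructor <;> rintro ⟨h1, h2⟩ <;> constructor <;> linarith
  rw [hset, gaussianReal_apply _ one_ne_zero]
  calc ∫⁻ x in Set.Icc ((-η - a) / s) ((η - a) / s), gaussianPDF 0 1 x
      ≤ ∫⁻ x in Set.Icc ((-η - a) / s) ((η - a) / s), ENNReal.ofReal (1 / √(2 * Real.pi)) := by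
        refine lintegral_mono fun x => ?_
        rw [gaussianPDF_def]
        refine ENNReal.ofReal_le_ofReal ?_
        rw [gaussianPDFReal_def]
        simp only [NNReal.coe_one, mul_one, one_div]
        refine mul_le_of_le_one_right (by positivity) (Real.exp_le_one_iff.mpr ?_)
        have := sq_nonneg (x - 0)
        linarith
    _ = _ := by
        rw [setLIntegral_const, Real.volume_Icc, ← ENNReal.ofReal_mul (by positivity)]
        congr 1
        field_simp
        ring

theorem gaussianVec_forall_abs_inner_le {n : ℕ} (hn : 0 < n) {ρ η : ℝ} (hρ : 0 < ρ)
    (u : Fin n → EuclideanSpace ℝ (Fin n)) (J : Finset (Fin n))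
    (hu : Orthonormal ℝ ((J : Set (Fin n)).domRestrict u)) (x : Fin n → ℝ) :
    gaussianVec n ρ {g | ∀ j ∈ J, |inner ℝ (u j) (WithLp.toLp 2 (x + g))| ≤ η} ≤
      ENNReal.ofReal (2 * η * √n / (ρ * √(2 * Real.pi))) ^ J.card := by
  set s : ℝ := ρ / √n with hs
  have hn' : (0 : ℝ) < n := Nat.cast_pos.mpr hn
  have hs0 : 0 < s := by positivity
  obtain ⟨B, hB⟩ := hu.exists_orthonormalBasis_extension_of_card_eq (by simp)
  have h1 : gaussianVec n ρ = (Measure.pi fun _ : Fin n => gaussianReal 0 1).map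
      (fun z i => s * z i) := by
    have : gaussianReal 0 (Real.toNNReal (ρ ^ 2 / n)) = (gaussianReal 0 1).map (s * ·) := by
      rw [gaussianReal_map_const_mul]
      congr 1
      · simp
      · ext
        simp [hs, div_pow, Real.sq_sqrt hn'.le,
          max_eq_left (show 0 ≤ ρ ^ 2 / (n : ℝ) by positivity)]
    have hp : ∀ _ : Fin n, SigmaFinite ((gaussianReal 0 1).map (s * ·)) := fun _ =>
      this ▸ inferInstance
    rw [gaussianVec, this, ← Measure.pi_map_pi (fun _ => by fun_prop)]
  have h2 : (Measure.pi fun _ : Fin n => gaussianReal 0 1) =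
      (Measure.pi fun _ : Fin n => gaussianReal 0 1).map
        (fun z => WithLp.ofLp (∑ i, z i • B i)) := by
    have e1 := map_pi_eq_stdGaussian (ι := Fin n)
    rw [stdGaussian_eq_map_pi_orthonormalBasis B] at e1
    have e2 := congrArg (Measure.map (WithLp.ofLp : EuclideanSpace ℝ (Fin n) → Fin n → ℝ)) e1
    rw [Measure.map_map (by fun_prop) (by fun_prop),
      Measure.map_map (by fun_prop) (by fun_prop)] at e2
    simpa [Function.comp_def] using e2
  have hmeas : MeasurableSet
      {g : Fin n → ℝ | ∀ j ∈ J, |inner ℝ (u j) (WithLp.toLp 2 (x + g))| ≤ η} := by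
    simp only [Set.ofPred_forall]
    refine Finset.measurableSet_biInter _ fun j _ => measurableSet_le ?_ measurable_const
    fun_prop
  rw [h1, h2, Measure.map_map (by fun_prop) (by fun_prop), Measure.map_apply (by fun_prop) hmeas]
  let P : Fin n → Set ℝ := fun j =>
    if j ∈ J then {t | |inner ℝ (u j) (WithLp.toLp 2 x) + s * t| ≤ η} else Set.univ
  have hpre : (((fun (z : Fin n → ℝ) i => s * z i) ∘
      fun (z : Fin n → ℝ) => WithLp.ofLp (∑ i, z i • B i)) ⁻¹'
      {g : Fin n → ℝ | ∀ j ∈ J, |inner ℝ (u j) (WithLp.toLp 2 (x + g))| ≤ η}) ⊆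
      Set.univ.pi P := by
    intro z hz j _
    by_cases hj : j ∈ J
    · simp only [P, hj, if_true]
      have h := hz j hj
      have e : WithLp.toLp 2 (x + fun i => s * (WithLp.ofLp (∑ i, z i • B i)) i) =
          WithLp.toLp 2 x + s • ∑ i, z i • B i := by
        ext i; simp
      have e' : inner ℝ (u j) (∑ i, z i • B i) = z j := by
        rw [← hB j hj]
        simp [inner_sum, inner_smul_right, OrthonormalBasis.inner_eq_ite]
      simp only [Function.comp_apply] at h
      rw [e, inner_add_right, inner_smul_right, e'] at h
      exact h
    · simp [P, hj]
  refine (measure_mono hpre).trans ?_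
  rw [Measure.pi_pi, ← Finset.prod_const]
  rw [← Finset.prod_subset (Finset.subset_univ J) (fun j _ hj => by simp [P, hj])]
  refine Finset.prod_le_prod' fun j hj => ?_
  simp only [P, hj, if_true]
  refine (gaussianReal_abs_add_mul_le _ hs0).trans (le_of_eq ?_)
  congr 1
  rw [hs]
  field_simp

theorem measure_smallOnFrame_le {D F : Type*} [NormedAddCommGroup D] [InnerProductSpace ℝ D]
    [FiniteDimensional ℝ D] [NormedAddCommGroup F] [InnerProductSpace ℝ F] [FiniteDimensional ℝ F]
    {n p κ m : ℕ} (hn : 0 < n) {ρ σ η : ℝ} (hρ : 0 < ρ) (hσ : 0 ≤ σ) (hση : n * σ < η)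
    (hq : 2 * η * √n / (ρ * √(2 * Real.pi)) ≤ 1)
    (M : EuclideanSpace ℝ (Fin n) →ₗ[ℝ] D →ₗ[ℝ] F)
    (hM : Continuous fun q : EuclideanSpace ℝ (Fin n) × D => M q.1 q.2)
    (hHS : ∀ a, ∑ i, ‖M (EuclideanSpace.single i 1) a‖ ^ 2 = ‖a‖ ^ 2)
    (hp : p + κ = Module.finrank ℝ D)
    (hm : ∀ c ≤ n, Module.finrank ℝ D ≤ (n - c) * κ + c * Module.finrank ℝ F → m ≤ c)
    (x : Fin n → ℝ) :
    gaussianVec n ρ {g | SmallOnFrame p σ (M (WithLp.toLp 2 (x + g)))} ≤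
      ENNReal.ofReal (2 * η * √n / (ρ * √(2 * Real.pi))) ^ m := by
  have hη : 0 < η := lt_of_le_of_lt (by positivity) hση
  have hunion : {g | SmallOnFrame p σ (M (WithLp.toLp 2 (x + g)))} =
      ⋃ R : ℕ, {g | SmallOnFrame p σ (M (WithLp.toLp 2 (x + g))) ∧
        ‖(WithLp.toLp 2 (x + g) : EuclideanSpace ℝ (Fin n))‖ ≤ R} := by
    refine Set.ext fun g => ⟨fun hg => ?_, fun hg => ?_⟩
    · obtain ⟨R, hR⟩ := exists_nat_ge ‖(WithLp.toLp 2 (x + g) : EuclideanSpace ℝ (Fin n))‖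
      exact Set.mem_iUnion.mpr ⟨R, hg, hR⟩
    · obtain ⟨R, hR⟩ := Set.mem_iUnion.mp hg
      exact hR.1
  rw [hunion, Monotone.measure_iUnion]
  swap
  · intro R R' hRR' g hg
    exact ⟨hg.1, hg.2.trans (Nat.cast_le.mpr hRR')⟩
  refine iSup_le fun R => ?_
  classical
  set K := {x | SmallOnFrame p σ (M x) ∧ ‖x‖ ≤ (R : ℝ)} with hK
  obtain ⟨v, c, hv, hvc, hc⟩ := exists_dual_system_of_isCompact K
    (isCompact_smallOnFrame M hM p σ R) hη
  have hcn : ∀ j, ‖c j‖ ≤ η⁻¹ := fun j =>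
    norm_le_inv_of_abs_inner_le_one hη fun b hb => hc j b (Or.inr hb)
  set J : Finset (Fin n) := Finset.univ.filter fun j => v j ∉ K with hJ
  have hJc : m ≤ J.card := by
    refine hm _ (by simpa using J.card_le_univ) ?_
    refine finrank_le_of_smallOnFrame M hHS hσ hση hp v c hvc hcn J fun j hj => ?_
    have : v j ∈ K := by simpa [hJ] using hj
    exact this.1
  have hJv : ∀ j ∈ J, v j = η ^ 2 • c j := by
    intro j hj
    have hj' : v j ∉ K := by simpa [hJ] using hj
    refine eq_smul_of_inner_eq_one hη (hcn j) ?_ (by simp [hvc])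
    simpa using (hv j).resolve_left hj'
  have hu : Orthonormal ℝ ((J : Set (Fin n)).domRestrict fun j => η • c j) := by
    rw [orthonormal_iff_ite]
    rintro ⟨i, hi⟩ ⟨j, hj⟩
    have h := hvc i j
    rw [hJv j hj, inner_smul_right] at h
    simp only [Set.domRestrict_apply, inner_smul_left, inner_smul_right, Subtype.mk.injEq]
    simp only [conj_trivial]
    rw [← h]
    ring
  have hsub : {g | SmallOnFrame p σ (M (WithLp.toLp 2 (x + g))) ∧
        ‖(WithLp.toLp 2 (x + g) : EuclideanSpace ℝ (Fin n))‖ ≤ R} ⊆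
      {g | ∀ j ∈ J, |inner ℝ (η • c j) (WithLp.toLp 2 (x + g))| ≤ η} := by
    intro g hg j _
    rw [inner_smul_left, conj_trivial, abs_mul, abs_of_pos hη]
    exact mul_le_of_le_one_right hη.le (hc j _ (Or.inl hg))
  refine (measure_mono hsub).trans ((gaussianVec_forall_abs_inner_le hn hρ _ J hu x).trans ?_)
  exact pow_le_pow_right_of_le_one' (by simpa using hq) hJc

/-- Evaluation of a tensor on a tuple of vectors. -/
def tensorEval {ℓ n : ℕ} (T : (Fin ℓ → Fin n) → ℝ) (y : Fin ℓ → Fin n → ℝ) : ℝ :=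
  ∑ f : Fin ℓ → Fin n, T f * ∏ t, y t (f t)

/-- Contraction of a linear combination of tensors along the first mode. -/
def contractFirst {ℓ n d : ℕ} (T : Fin d → EuclideanSpace ℝ (Fin (ℓ + 1) → Fin n)) :
    EuclideanSpace ℝ (Fin n) →ₗ[ℝ] EuclideanSpace ℝ (Fin d) →ₗ[ℝ]
      EuclideanSpace ℝ (Fin ℓ → Fin n) :=
  LinearMap.mk₂ ℝ (fun x a => WithLp.toLp 2 fun f => ∑ i, ∑ j, x i * a j * T j (Fin.cons i f))
    (fun x y a => by ext f; simp [add_mul, Finset.sum_add_distrib])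
    (fun c x a => by ext f; simp [Finset.mul_sum, mul_assoc])
    (fun x a b => by ext f; simp [mul_add, add_mul, Finset.sum_add_distrib])
    (fun c x a => by ext f; simp [Finset.mul_sum]; congr! 2; ring)

theorem contractFirst_apply {ℓ n d : ℕ} (T : Fin d → EuclideanSpace ℝ (Fin (ℓ + 1) → Fin n))
    (x : EuclideanSpace ℝ (Fin n)) (a : EuclideanSpace ℝ (Fin d)) (f : Fin ℓ → Fin n) :
    contractFirst T x a f = ∑ i, ∑ j, x i * a j * T j (Fin.cons i f) := rfl

theorem continuous_contractFirst {ℓ n d : ℕ}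
    (T : Fin d → EuclideanSpace ℝ (Fin (ℓ + 1) → Fin n)) :
    Continuous fun q : EuclideanSpace ℝ (Fin n) × EuclideanSpace ℝ (Fin d) =>
      contractFirst T q.1 q.2 := by
  change Continuous fun q : EuclideanSpace ℝ (Fin n) × EuclideanSpace ℝ (Fin d) =>
    (WithLp.toLp 2 fun f => ∑ i, ∑ j, q.1 i * q.2 j * T j (Fin.cons i f) :
      EuclideanSpace ℝ (Fin ℓ → Fin n))
  fun_prop

theorem sum_fin_succ_pi {ℓ n : ℕ} (φ : (Fin (ℓ + 1) → Fin n) → ℝ) :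
    ∑ f, φ f = ∑ i, ∑ f : Fin ℓ → Fin n, φ (Fin.cons i f) := by
  rw [← (Fin.consEquiv fun _ : Fin (ℓ + 1) => Fin n).sum_comp, Fintype.sum_prod_type]
  rfl

theorem sum_norm_sq_contractFirst {ℓ n d : ℕ}
    {T : Fin d → EuclideanSpace ℝ (Fin (ℓ + 1) → Fin n)} (hT : Orthonormal ℝ T)
    (a : EuclideanSpace ℝ (Fin d)) :
    ∑ i, ‖contractFirst T (EuclideanSpace.single i 1) a‖ ^ 2 = ‖a‖ ^ 2 := by
  have h1 : ‖∑ j, a j • T j‖ ^ 2 = ‖a‖ ^ 2 := by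
    rw [← real_inner_self_eq_norm_sq, hT.inner_sum, EuclideanSpace.real_norm_sq_eq]
    simp [sq]
  rw [← h1, EuclideanSpace.real_norm_sq_eq, sum_fin_succ_pi]
  refine Finset.sum_congr rfl fun i _ => ?_
  rw [EuclideanSpace.real_norm_sq_eq]
  refine Finset.sum_congr rfl fun f _ => ?_
  rw [contractFirst_apply, Finset.sum_eq_single i]
  · simp
  · intro b _ hb
    simp [hb]
  · simp

theorem tensorEval_contractFirst {ℓ n d : ℕ}
    (T : Fin d → EuclideanSpace ℝ (Fin (ℓ + 1) → Fin n)) (a : EuclideanSpace ℝ (Fin d))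
    (y : Fin (ℓ + 1) → Fin n → ℝ) :
    tensorEval (contractFirst T (WithLp.toLp 2 (y 0)) a) (fun t => y t.succ) =
      ∑ j, a j * tensorEval (T j) y := by
  simp only [tensorEval, contractFirst_apply, sum_fin_succ_pi, Fin.prod_univ_succ, Fin.cons_zero,
    Fin.cons_succ, Finset.mul_sum, Finset.sum_mul]
  rw [Finset.sum_comm]
  conv_rhs => rw [Finset.sum_comm]
  refine Finset.sum_congr rfl fun i _ => ?_
  rw [Finset.sum_comm]
  refine Finset.sum_congr rfl fun j _ => Finset.sum_congr rfl fun f _ => ?_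
  ring

theorem tensorEval_smul {ℓ n : ℕ} (c : ℝ) (T : EuclideanSpace ℝ (Fin ℓ → Fin n))
    (y : Fin ℓ → Fin n → ℝ) : tensorEval (c • T) y = c * tensorEval T y := by
  simp [tensorEval, Finset.mul_sum, mul_assoc]

/-- If the contraction by the first vector has many large singular values, then its image contains
an orthonormal family controlling the evaluations of the original family. -/
theorem exists_orthonormal_of_not_smallOnFrame {ℓ n d p κ : ℕ}
    (T : Fin d → EuclideanSpace ℝ (Fin (ℓ + 1) → Fin n)) (hp : p + κ = d) {σ : ℝ} (hσ : 0 < σ)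
    (y₀ : Fin n → ℝ) (hy₀ : ¬ SmallOnFrame p σ (contractFirst T (WithLp.toLp 2 y₀))) :
    ∃ w : Fin (κ + 1) → EuclideanSpace ℝ (Fin ℓ → Fin n), Orthonormal ℝ w ∧
      ∀ y : Fin (ℓ + 1) → Fin n → ℝ, y 0 = y₀ →
        σ ^ 2 * ∑ i, tensorEval (w i) (fun t => y t.succ) ^ 2 ≤ ∑ j, tensorEval (T j) y ^ 2 := by
  obtain ⟨B, s, e, hB, hs⟩ := exists_singular_basis_of_not_smallOnFrame (by simp) hp hy₀
  have hs0 : ∀ i, 0 < s (e i) := fun i => (pow_pos hσ 2).trans (hs i)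
  refine ⟨fun i => (√(s (e i)))⁻¹ • contractFirst T (WithLp.toLp 2 y₀) (B (e i)), ?_, ?_⟩
  · rw [orthonormal_iff_ite]
    intro i j
    rw [inner_smul_left, inner_smul_right, hB]
    by_cases hij : i = j
    · subst hij
      have h1 := Real.mul_self_sqrt (hs0 i).le
      have h2 := Real.sqrt_pos.mpr (hs0 i)
      simp only [if_true, conj_trivial]
      field_simp
      nlinarith
    · simp [hij]
  · rintro y rfl
    let τ : EuclideanSpace ℝ (Fin d) := WithLp.toLp 2 fun j => tensorEval (T j) y
    have h1 : ∑ j, tensorEval (T j) y ^ 2 = ∑ i, inner ℝ (B i) τ ^ 2 := by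
      have := B.sum_sq_norm_inner_right τ
      simp only [Real.norm_eq_abs, sq_abs] at this
      rw [this, EuclideanSpace.real_norm_sq_eq]
    have h2 : ∀ b : EuclideanSpace ℝ (Fin d), inner ℝ b τ =
        tensorEval (contractFirst T (WithLp.toLp 2 (y 0)) b) (fun t => y t.succ) := by
      intro b
      rw [tensorEval_contractFirst]
      simp [PiLp.inner_apply, τ, mul_comm]
    have h3 : ∑ i, inner ℝ (B (e i)) τ ^ 2 ≤ ∑ i, inner ℝ (B i) τ ^ 2 := by
      rw [← Finset.sum_map Finset.univ e fun i => inner ℝ (B i) τ ^ 2]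
      exact Finset.sum_le_sum_of_subset_of_nonneg (Finset.subset_univ _) fun _ _ _ => sq_nonneg _
    rw [h1, Finset.mul_sum]
    refine le_trans (Finset.sum_le_sum fun i _ => ?_) h3
    rw [h2]
    have h4 := tensorEval_smul (√(s (e i)))⁻¹
      (contractFirst T (WithLp.toLp 2 (y 0)) (B (e i))) (fun t => y t.succ)
    simp only [WithLp.ofLp_smul] at h4 ⊢
    rw [h4, mul_pow, inv_pow, Real.sq_sqrt (hs0 i).le, ← mul_assoc]
    refine mul_le_of_le_one_left (sq_nonneg _) ?_
    rw [← div_eq_mul_inv, div_le_one (hs0 i)]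
    exact (hs i).le

instance (n : ℕ) (ρ : ℝ) : IsProbabilityMeasure (gaussianVec n ρ) := by
  unfold gaussianVec
  infer_instance

theorem measurable_tensorEval_add {ℓ n : ℕ} (T : (Fin ℓ → Fin n) → ℝ) (x : Fin ℓ → Fin n → ℝ) :
    Measurable fun g : Fin ℓ → Fin n → ℝ => tensorEval T (x + g) := by
  unfold tensorEval
  simp only [Pi.add_apply]
  fun_prop

theorem measure_prod_le_add {α β : Type*} [MeasurableSpace α] [MeasurableSpace β] {μ : Measure α}
    {ν : Measure β} [IsProbabilityMeasure μ] [IsProbabilityMeasure ν] {S : Set (α × β)}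
    (hS : MeasurableSet S) {A : Set α} {r : ENNReal}
    (h : ∀ a ∉ A, ν (Prod.mk a ⁻¹' S) ≤ r) : μ.prod ν S ≤ μ A + r := by
  rw [Measure.prod_apply hS]
  calc ∫⁻ a, ν (Prod.mk a ⁻¹' S) ∂μ
      ≤ ∫⁻ a, (toMeasurable μ A).indicator 1 a + r ∂μ := by
        refine lintegral_mono fun a => ?_
        by_cases ha : a ∈ toMeasurable μ A
        · simp only [ha, Set.indicator_of_mem, Pi.one_apply]
          exact prob_le_one.trans le_self_add
        · exact (h a fun h' => ha (subset_toMeasurable μ A h')).trans le_add_self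
    _ = μ A + r := by
        rw [lintegral_add_right _ measurable_const,
          lintegral_indicator_one (measurableSet_toMeasurable μ A), measure_toMeasurable]
        simp

theorem measure_sum_sq_tensorEval_lt_le {n : ℕ} (hn : 0 < n) {ρ σ η γ : ℝ} (hρ : 0 < ρ)
    (hσ : 0 < σ) (hση : n * σ < η) (hq : 2 * η * √n / (ρ * √(2 * Real.pi)) ≤ 1) (hγ : 0 < γ)
    (ℓ d : ℕ) (T : Fin d → EuclideanSpace ℝ (Fin ℓ → Fin n)) (hT : Orthonormal ℝ T) (hd : 1 ≤ d)
    (hdim : ℓ * γ * (n : ℝ) ^ ℓ ≤ d) (x : Fin ℓ → Fin n → ℝ) :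
    (Measure.pi fun _ : Fin ℓ => gaussianVec n ρ)
        {g | ∑ j, tensorEval (T j) (x + g) ^ 2 < (σ ^ 2) ^ ℓ} ≤
      ℓ * ENNReal.ofReal (2 * η * √n / (ρ * √(2 * Real.pi))) ^ ⌈γ * n⌉₊ := by
  induction ℓ generalizing d with
  | zero =>
    refine le_of_eq_of_le ?_ zero_le
    refine (congrArg _ (Set.eq_empty_iff_forall_notMem.mpr fun g hg => ?_)).trans measure_empty
    have h1 : ∀ j, tensorEval (T j) (x + g) ^ 2 = 1 := by
      intro j
      have := EuclideanSpace.real_norm_sq_eq (T j)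
      rw [hT.1 j] at this
      simpa [tensorEval] using this.symm
    have h2 : ∑ j, tensorEval (T j) (x + g) ^ 2 < (σ ^ 2) ^ 0 := hg
    simp only [h1, Finset.sum_const, Finset.card_univ, Fintype.card_fin, nsmul_eq_mul, mul_one,
      pow_zero] at h2
    exact absurd h2 (not_lt.mpr (by exact_mod_cast hd))
  | succ ℓ ih =>
    have hn' : (0 : ℝ) < n := Nat.cast_pos.mpr hn
    set q := ENNReal.ofReal (2 * η * √n / (ρ * √(2 * Real.pi)))
    set κ := ⌈ℓ * γ * (n : ℝ) ^ ℓ⌉₊ - 1 with hκ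
    have hκ1 : ℓ * γ * (n : ℝ) ^ ℓ ≤ (κ + 1 : ℕ) :=
      (Nat.le_ceil _).trans (Nat.cast_le.mpr (by omega))
    have hκ2 : (κ : ℝ) ≤ ℓ * γ * (n : ℝ) ^ ℓ := by
      rcases Nat.eq_zero_or_pos κ with h | h
      · rw [h, Nat.cast_zero]; positivity
      · exact (Nat.lt_ceil.mp (by omega)).le
    push_cast at hdim
    have hn1 : (1 : ℝ) ≤ n := by exact_mod_cast hn
    have hκd : κ ≤ d := by
      have : (κ : ℝ) ≤ d := by
        refine hκ2.trans (le_trans ?_ hdim)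
        gcongr
        · exact le_add_of_nonneg_right zero_le_one
        · exact Nat.le_succ ℓ
      exact_mod_cast this
    have hp : d - κ + κ = d := Nat.sub_add_cancel hκd
    have hfin : Module.finrank ℝ (EuclideanSpace ℝ (Fin ℓ → Fin n)) = n ^ ℓ := by simp
    have hbad := measure_smallOnFrame_le (m := ⌈γ * n⌉₊) hn hρ hσ.le hση hq (contractFirst T)
      (continuous_contractFirst T) (sum_norm_sq_contractFirst hT) (by simpa using hp) (by
        intro c hc hle
        rw [hfin, finrank_euclideanSpace_fin] at hle
        have hle' : (d : ℝ) ≤ (n - c) * κ + c * (n : ℝ) ^ ℓ := by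
          rw [← Nat.cast_sub hc]; exact_mod_cast hle
        have hcn : (c : ℝ) ≤ n := Nat.cast_le.mpr hc
        have hN : (0 : ℝ) < (n : ℝ) ^ ℓ := by positivity
        refine Nat.ceil_le.mpr (le_of_mul_le_mul_right ?_ hN)
        have h1 : (n - c) * (κ : ℝ) ≤ (n - c) * (ℓ * γ * (n : ℝ) ^ ℓ) :=
          mul_le_mul_of_nonneg_left hκ2 (by linarith)
        have h2 : 0 ≤ (c : ℝ) * (ℓ * γ * (n : ℝ) ^ ℓ) := by positivity
        rw [pow_succ] at hdim
        nlinarith) (x 0)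
    have hmeas : MeasurableSet {g : Fin (ℓ + 1) → Fin n → ℝ |
        ∑ j, tensorEval (T j) (x + g) ^ 2 < (σ ^ 2) ^ (ℓ + 1)} :=
      measurableSet_lt (Finset.measurable_sum _ fun j _ =>
        (measurable_tensorEval_add (T j) x).pow_const 2) measurable_const
    have hmp := (measurePreserving_piFinSuccAbove
      (fun _ : Fin (ℓ + 1) => gaussianVec n ρ) 0).symm
    rw [← hmp.measure_preimage hmeas.nullMeasurableSet]
    refine (measure_prod_le_add (hmp.measurable hmeas) fun g₀ hg₀ => ?_).trans
      ((add_le_add_left hbad (ℓ * q ^ ⌈γ * n⌉₊)).trans_eq ?_)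
    · obtain ⟨w, hw, hTw⟩ := exists_orthonormal_of_not_smallOnFrame T hp hσ (x 0 + g₀) hg₀
      refine (measure_mono fun g hg => ?_).trans
        (ih (κ + 1) w hw (by omega) hκ1 fun t => x t.succ)
      have h1 := hTw (x + Fin.cons g₀ g) (by simp)
      have h2 : ∑ j, tensorEval (T j) (x + Fin.cons g₀ g) ^ 2 < (σ ^ 2) ^ (ℓ + 1) := by
        have e : (MeasurableEquiv.piFinSuccAbove (fun _ : Fin (ℓ + 1) => Fin n → ℝ) 0).symm
            (g₀, g) = Fin.cons g₀ g := Fin.insertNth_zero' g₀ g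
        rw [← e]
        exact hg
      have h3 := h1.trans_lt h2
      rw [pow_succ' (σ ^ 2)] at h3
      exact lt_of_mul_lt_mul_left h3 (by positivity)
    · push_cast
      ring

theorem rpow_le_mul_of_log_bound {n : ℝ} (hn : 2 ≤ n) {ℓ : ℕ} (hℓ : 1 ≤ ℓ) :
    n ^ ((1 : ℝ) / (2 * ℓ) ^ ℓ) ≤
      n * ((0.18 + (3 ^ ℓ / ℓ - ℓ - 1) * Real.log n) / ℓ) := by
  have hlog : 0.693 ≤ Real.log n := by
    have := Real.log_two_gt_d9
    have := Real.log_le_log (by norm_num) hn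
    linarith
  have h1n : 1 ≤ n := by linarith
  obtain rfl | hℓ2 := hℓ.eq_or_lt
  · have h : n ^ ((1 : ℝ) / (2 * (1 : ℕ)) ^ 1) = √n := by
      rw [Real.sqrt_eq_rpow]; norm_num
    rw [h, Real.sqrt_le_iff]
    norm_num
    have h2 : n * 0.8 ≤ n * (9 / 50 + Real.log n) := by gcongr; linarith
    refine ⟨by positivity, ?_⟩
    calc n ≤ (n * 0.8) ^ 2 := by nlinarith
      _ ≤ _ := by gcongr
  · have hquarter : n ^ ((1 : ℝ) / (2 * ℓ) ^ ℓ) ≤ n * 0.6 := by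
      have hk : (4 : ℝ) ≤ (2 * ℓ) ^ ℓ := by
        have h2 : (2 : ℝ) ≤ ℓ := by exact_mod_cast hℓ2
        calc (4 : ℝ) = 2 ^ 2 := by norm_num
          _ ≤ (2 * ℓ) ^ 2 := by gcongr; linarith
          _ ≤ (2 * ℓ) ^ ℓ := pow_le_pow_right₀ (by linarith) hℓ2
      have h1 : n ^ ((1 : ℝ) / (2 * ℓ) ^ ℓ) ≤ n ^ ((1 : ℝ) / 4) :=
        Real.rpow_le_rpow_of_exponent_le h1n (one_div_le_one_div_of_le (by norm_num) hk)
      refine h1.trans ?_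
      set y := n ^ ((1 : ℝ) / 4) with hy
      have hy4 : y ^ 4 = n := by
        rw [hy, ← Real.rpow_natCast, ← Real.rpow_mul (by linarith)]
        norm_num
      have hy0 : 0 < y := by positivity
      have hy1 : 1.189 ≤ y := by
        by_contra! hlt
        have : y ^ 4 < 1.189 ^ 4 := by gcongr
        norm_num at this
        linarith
      have hy3 : (1.189 : ℝ) ^ 3 ≤ y ^ 3 := by gcongr
      rw [← hy4]
      norm_num at hy3
      nlinarith
    refine hquarter.trans ?_
    gcongr
    have hℓ0 : (0 : ℝ) < ℓ := by exact_mod_cast hℓ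
    rw [le_div_iff₀ hℓ0]
    obtain rfl | hℓ3 := (Nat.succ_le_of_lt hℓ2).eq_or_lt
    · norm_num
      linarith
    · have h3 : ∀ k : ℕ, 3 ≤ k → (2 * k ^ 2 + k : ℝ) ≤ 3 ^ k := by
        intro k hk
        induction k, hk using Nat.le_induction with
        | base => norm_num
        | succ k hk ih =>
          have : (3 : ℝ) ≤ k := by exact_mod_cast hk
          rw [pow_succ (3 : ℝ) k]
          push_cast
          nlinarith
      have h4 : (ℓ : ℝ) ≤ 3 ^ ℓ / ℓ - ℓ - 1 := by
        have : (2 * ℓ + 1 : ℝ) ≤ 3 ^ ℓ / ℓ := by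
          rw [le_div_iff₀ hℓ0]
          have := h3 ℓ hℓ3
          nlinarith
        linarith
      nlinarith [mul_le_mul_of_nonneg_right h4 (by linarith : 0 ≤ Real.log n)]

theorem mul_pow_ceil_le_exp {n : ℝ} (hn : 2 ≤ n) {ℓ : ℕ} (hℓ : 1 ≤ ℓ) {δ : ℝ} (hδ : 0 < δ) :
    ℓ * (0.82 * n ^ (2 - 3 ^ ℓ / ℓ : ℝ)) ^ ⌈δ / ℓ * n⌉₊ ≤
      Real.exp (-δ * n ^ ((1 : ℝ) / (2 * ℓ) ^ ℓ)) := by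
  set L := 0.18 + (3 ^ ℓ / ℓ - ℓ - 1) * Real.log n with hL
  have hkey := rpow_le_mul_of_log_bound hn hℓ
  rw [← hL] at hkey
  have hn0 : 0 < n := by linarith
  have hℓ0 : (0 : ℝ) < ℓ := by exact_mod_cast hℓ
  have hL0 : 0 < L := by
    have : 0 < n * (L / ℓ) := lt_of_lt_of_le (by positivity) hkey
    have := (mul_pos_iff_of_pos_left hn0).mp this
    exact (div_pos_iff_of_pos_right hℓ0).mp this
  set q := 0.82 * n ^ (2 - 3 ^ ℓ / ℓ : ℝ) with hq
  have hq0 : 0 < q := by positivity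
  have hℓq : ℓ * q ≤ Real.exp (-L) := by
    rw [← Real.log_le_iff_le_exp (by positivity), Real.log_mul hℓ0.ne' hq0.ne', hq,
      Real.log_mul (by norm_num) (by positivity), Real.log_rpow hn0]
    have h1 : Real.log 0.82 ≤ -0.18 := by
      have := Real.log_le_sub_one_of_pos (show (0 : ℝ) < 0.82 by norm_num)
      linarith
    have h2 : Real.log ℓ ≤ (ℓ - 1) * Real.log n := by
      have h3 : (ℓ : ℝ) ≤ n ^ (ℓ - 1) := by
        have : ℓ ≤ 2 ^ (ℓ - 1) := by
          have := (ℓ - 1).lt_two_pow_self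
          omega
        calc (ℓ : ℝ) ≤ 2 ^ (ℓ - 1) := by exact_mod_cast this
          _ ≤ n ^ (ℓ - 1) := by gcongr
      have := Real.log_le_log hℓ0 h3
      rwa [Real.log_pow, Nat.cast_sub hℓ, Nat.cast_one] at this
    rw [hL]
    linarith
  set m := ⌈δ / ℓ * n⌉₊ with hm
  have hm1 : m ≠ 0 := (Nat.ceil_pos.mpr (by positivity)).ne'
  have hℓ1 : (1 : ℝ) ≤ ℓ := by exact_mod_cast hℓ
  calc ℓ * q ^ m ≤ ℓ ^ m * q ^ m := by
        gcongr
        exact le_self_pow₀ hℓ1 hm1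
    _ = (ℓ * q) ^ m := (mul_pow _ _ _).symm
    _ ≤ Real.exp (-L) ^ m := by gcongr
    _ = Real.exp (m * -L) := (Real.exp_nat_mul _ _).symm
    _ ≤ _ := by
      refine Real.exp_le_exp.mpr ?_
      have h1 : δ / ℓ * n * L ≤ m * L := mul_le_mul_of_nonneg_right (Nat.le_ceil _) hL0.le
      have h2 := mul_le_mul_of_nonneg_left hkey hδ.le
      have h3 : δ * (n * (L / ℓ)) = δ / ℓ * n * L := by ring
      linarith

theorem two_mul_div_sqrt_two_pi_le {n ρ a : ℝ} (hn : 0 < n) (hρ : 0 < ρ) :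
    2 * (1.01 * (n * (ρ * n ^ (1 / 2 - a)))) * √n / (ρ * √(2 * Real.pi)) ≤
      0.82 * n ^ (2 - a) := by
  have h1 : (2.5 : ℝ) ≤ √(2 * Real.pi) := by
    refine Real.le_sqrt_of_sq_le ?_
    have := Real.pi_gt_d4
    norm_num at this ⊢
    linarith
  have h2 : n * n ^ (1 / 2 - a) * √n = n ^ (2 - a) := by
    have : n ^ (2 - a) = n ^ (1 : ℝ) * n ^ (1 / 2 - a) * n ^ (1 / 2 : ℝ) := by
      rw [← Real.rpow_add hn, ← Real.rpow_add hn]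
      congr 1
      ring
    rw [this, Real.rpow_one, Real.sqrt_eq_rpow]
  rw [div_le_iff₀ (by positivity), ← h2]
  have h3 : 0 ≤ ρ * (n * n ^ (1 / 2 - a) * √n) := by positivity
  nlinarith [mul_le_mul_of_nonneg_left h1 h3]

/-- for any subspace 𝒱 of dimension δ·n^ℓ of order-ℓ tensors, there exist
unit Frobenius norm tensors T₁,…,T_r ∈ 𝒱 such that for ρ-perturbations of any vectors
x^{(1)},…,x^{(ℓ)}, with probability ≥ 1 − exp(−δ n^{1/(2ℓ)^ℓ}) some T_j has
|T_j(x̃^{(1)},…,x̃^{(ℓ)})| ≥ ρ^ℓ (1/n)^{3^ℓ}. -/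
theorem projection_of_perturbed_product_vectors (δ : ℝ) (hδ₀ : 0 < δ) (hδ₁ : δ < 1)
    (ℓ n : ℕ) (hn : 0 < n) (ρ : ℝ) (hρ : 0 < ρ)
    (V : Submodule ℝ ((Fin ℓ → Fin n) → ℝ))
    (hdim : (Module.finrank ℝ V : ℝ) = δ * (n : ℝ) ^ ℓ) :
    ∃ (r : ℕ) (T : Fin r → (Fin ℓ → Fin n) → ℝ),
      (∀ j, T j ∈ V ∧ enorm2 (T j) = 1) ∧
      ∀ x : Fin ℓ → Fin n → ℝ,
        ENNReal.ofReal (1 - Real.exp (-δ * (n : ℝ) ^ ((1 : ℝ) / (2 * ℓ) ^ ℓ))) ≤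
          (Measure.pi fun _ : Fin ℓ => gaussianVec n ρ)
            {g | ∃ j : Fin r,
              ρ ^ ℓ * (1 / (n : ℝ)) ^ 3 ^ ℓ ≤
                |∑ f : Fin ℓ → Fin n, T j f * ∏ t, (x t (f t) + g t (f t))|} := by
  have hn0 : (0 : ℝ) < n := Nat.cast_pos.mpr hn
  set d := Module.finrank ℝ V with hd
  have hd1 : 1 ≤ d := by
    have : (0 : ℝ) < d := by rw [hdim]; positivity
    exact_mod_cast this
  have hdlt : d < n ^ ℓ := by
    have : (d : ℝ) < (n : ℝ) ^ ℓ := by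
      rw [hdim]
      exact mul_lt_of_lt_one_left (by positivity) hδ₁
    exact_mod_cast this
  have hℓ : 1 ≤ ℓ := by
    by_contra! h
    obtain rfl : ℓ = 0 := by omega
    simp at hdlt
    omega
  have hn2 : 2 ≤ n := by
    by_contra! h
    obtain rfl : n = 1 := by omega
    simp at hdlt
    omega
  let e := (WithLp.linearEquiv 2 ℝ ((Fin ℓ → Fin n) → ℝ)).symm
  let V' : Submodule ℝ (EuclideanSpace ℝ (Fin ℓ → Fin n)) := V.map e.toLinearMap
  have hV' : Module.finrank ℝ V' = d := e.finrank_map_eq V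
  let B := (stdOrthonormalBasis ℝ V').reindex (finCongr hV')
  let T : Fin d → EuclideanSpace ℝ (Fin ℓ → Fin n) := fun j => B j
  have hT : Orthonormal ℝ T := B.orthonormal.comp_linearIsometry V'.subtypeₗᵢ
  refine ⟨d, fun j => T j, fun j => ⟨?_, ?_⟩, fun x => ?_⟩
  · obtain ⟨w, hw, hwe⟩ := (B j).2
    have : (T j).ofLp = w := congrArg WithLp.ofLp hwe.symm
    change (T j).ofLp ∈ V
    rw [this]
    exact hw
  · rw [enorm2, ← EuclideanSpace.real_norm_sq_eq, Real.sqrt_sq (norm_nonneg _)]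
    exact hT.1 j
  have hℓ0 : (0 : ℝ) < ℓ := by exact_mod_cast hℓ
  set a : ℝ := 3 ^ ℓ / ℓ with ha
  set σ : ℝ := ρ * (n : ℝ) ^ (1 / 2 - a) with hσ
  have hσ0 : 0 < σ := by positivity
  have hq := two_mul_div_sqrt_two_pi_le (a := a) hn0 hρ
  rw [← hσ] at hq
  have hfail := mul_pow_ceil_le_exp (n := n) (by exact_mod_cast hn2) hℓ hδ₀
  have hq1 : (0.82 : ℝ) * (n : ℝ) ^ (2 - a) ≤ 1 := by
    have ha2 : 2 ≤ a := by
      rw [ha, le_div_iff₀ hℓ0]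
      have := one_add_mul_le_pow (show (-2 : ℝ) ≤ 2 by norm_num) ℓ
      norm_num at this
      linarith
    have := Real.rpow_le_one_of_one_le_of_nonpos (x := n) (by exact_mod_cast hn)
      (show 2 - a ≤ 0 by linarith)
    linarith
  have hmain := measure_sum_sq_tensorEval_lt_le hn hρ hσ0
    (η := 1.01 * (n * σ)) (by nlinarith [mul_pos hn0 hσ0]) (hq.trans hq1)
    (div_pos hδ₀ hℓ0) ℓ d T hT hd1 (by rw [hdim, mul_div_cancel₀ _ hℓ0.ne']) x
  have hthr : d * (ρ ^ ℓ * (1 / (n : ℝ)) ^ 3 ^ ℓ) ^ 2 ≤ (σ ^ 2) ^ ℓ := by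
    have h1 : (d : ℝ) ≤ (n : ℝ) ^ ℓ := by exact_mod_cast hdlt.le
    have h2 : (σ ^ 2) ^ ℓ = (n : ℝ) ^ ℓ * (ρ ^ ℓ * (1 / (n : ℝ)) ^ 3 ^ ℓ) ^ 2 := by
      have h3 : ((n : ℝ) ^ (1 / 2 - a)) ^ (2 * ℓ) = (n : ℝ) ^ ℓ * ((1 / (n : ℝ)) ^ 3 ^ ℓ) ^ 2 := by
        rw [one_div (n : ℝ), inv_pow, inv_pow, ← div_eq_mul_inv, ← pow_mul,
          ← Real.rpow_natCast _ (2 * ℓ), ← Real.rpow_natCast _ ℓ, ← Real.rpow_natCast _ (3 ^ ℓ * 2),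
          ← Real.rpow_sub hn0, ← Real.rpow_mul hn0.le]
        congr 1
        push_cast
        rw [ha]
        field_simp
      rw [← pow_mul, hσ, mul_pow, h3]
      ring
    rw [h2]
    gcongr
  set μ := Measure.pi fun _ : Fin ℓ => gaussianVec n ρ
  set S := {g : Fin ℓ → Fin n → ℝ | ∃ j : Fin d,
    ρ ^ ℓ * (1 / (n : ℝ)) ^ 3 ^ ℓ ≤ |∑ f : Fin ℓ → Fin n, T j f * ∏ t, (x t (f t) + g t (f t))|}
  have hcover : Set.univ ⊆ S ∪ {g | ∑ j, tensorEval (T j) (x + g) ^ 2 < (σ ^ 2) ^ ℓ} := by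
    intro g _
    by_cases hg : g ∈ S
    · exact Or.inl hg
    right
    have hlt : ∀ j, |tensorEval (T j) (x + g)| < ρ ^ ℓ * (1 / (n : ℝ)) ^ 3 ^ ℓ :=
      fun j => not_le.mp fun h => hg ⟨j, h⟩
    refine lt_of_lt_of_le ?_ hthr
    have : Nonempty (Fin d) := ⟨⟨0, hd1⟩⟩
    calc ∑ j, tensorEval (T j) (x + g) ^ 2
        < ∑ _j : Fin d, (ρ ^ ℓ * (1 / (n : ℝ)) ^ 3 ^ ℓ) ^ 2 :=
          Finset.sum_lt_sum_of_nonempty Finset.univ_nonempty fun j _ => by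
            rw [← sq_abs]
            exact pow_lt_pow_left₀ (hlt j) (abs_nonneg _) two_ne_zero
      _ = _ := by simp
  rw [ENNReal.ofReal_sub _ (Real.exp_nonneg _), ENNReal.ofReal_one, tsub_le_iff_right]
  calc 1 = μ Set.univ := measure_univ.symm
    _ ≤ μ S + μ {g | ∑ j, tensorEval (T j) (x + g) ^ 2 < (σ ^ 2) ^ ℓ} :=
      (measure_mono hcover).trans (measure_union_le _ _)
    _ ≤ μ S + _ := by
      gcongr
      refine hmain.trans (le_trans ?_ (ENNReal.ofReal_le_ofReal hfail))
      rw [ENNReal.ofReal_mul (by positivity), ENNReal.ofReal_natCast,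
        ENNReal.ofReal_pow (by positivity)]
      gcongr

end
end

section
/- Given any constant δ ∈ (0,1) and any matrix T of size r × n^ℓ such that the (δn^ℓ)-th largest singular value of T satisfies σ_{δn^ℓ}(T) ≥ η, for ρ-perturbations x̃^(1), x̃^(2), ..., x̃^(ℓ) ∈ ℝ^n of any vectors x^(1), x^(2), ..., x^(ℓ) ∈ ℝ^n, we have ‖T(x̃^(1) ⊗ x̃^(2) ⊗ ... ⊗ x̃^(ℓ))‖ ≥ η ρ^ℓ (1/n)^{3^{O(ℓ)}} with probability at least 1 − exp(−δ n^{1/3^ℓ}). -/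
open MeasureTheory ProbabilityTheory

noncomputable section

/-- The `k`-th largest singular value of a real matrix, via the Courant–Fischer
characterization. -/
def singVal {ι κ : Type*} [Fintype ι] [Fintype κ] (A : Matrix ι κ ℝ) (k : ℕ) : ℝ :=
  sSup {s : ℝ | ∃ V : Submodule ℝ (κ → ℝ), Module.finrank ℝ V = k ∧
    s = sInf {t : ℝ | ∃ x ∈ V, enorm2 x = 1 ∧ t = enorm2 (A.mulVec x)}}

section LinearAlgebra

variable {E G : Type*} [NormedAddCommGroup E] [InnerProductSpace ℝ E]
  [NormedAddCommGroup G] [InnerProductSpace ℝ G]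

theorem inner_orthonormalBasis_eq_zero_of_mem_span {ι : Type*} [Fintype ι]
    (b : OrthonormalBasis ι ℝ E) (p : ι → Prop) {s : E}
    (hs : s ∈ Submodule.span ℝ (Set.range fun i : {i // p i} => b i)) {j : ι} (hj : ¬ p j) :
    inner ℝ (b j) s = 0 := by
  induction hs using Submodule.span_induction with
  | mem x hx =>
    obtain ⟨⟨i, hi⟩, rfl⟩ := hx
    exact b.orthonormal.2 fun h => hj (h ▸ hi)
  | zero => simp
  | add x y _ _ hx hy => simp [inner_add_right, hx, hy]
  | smul a x _ hx => simp [inner_smul_right, hx]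

theorem finrank_span_orthonormalBasis_subtype {ι : Type*} [Fintype ι]
    (b : OrthonormalBasis ι ℝ E) (p : ι → Prop) [Fintype {i // p i}] :
    Module.finrank ℝ (Submodule.span ℝ (Set.range fun i : {i // p i} => b i)) =
      Fintype.card {i // p i} :=
  finrank_span_eq_card (b.orthonormal.linearIndependent.comp _ Subtype.val_injective)

variable [FiniteDimensional ℝ E] [FiniteDimensional ℝ G]

theorem exists_singular_split_top (M : E →ₗ[ℝ] G) {c : ℝ} (hc : 0 ≤ c) :
    ∃ S S' : Submodule ℝ E,
      Module.finrank ℝ S + Module.finrank ℝ S' = Module.finrank ℝ E ∧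
      (∀ s ∈ S, s ≠ 0 → c * ‖s‖ < ‖M s‖) ∧ ∀ s ∈ S', ‖M s‖ ≤ c * ‖s‖ := by
  classical
  have hT := M.isSymmetric_adjoint_comp_self
  set b := hT.eigenvectorBasis rfl with hb
  set l := hT.eigenvalues rfl with hl
  have hM (s : E) : ‖M s‖ ^ 2 = ∑ i, l i * inner ℝ (b i) s ^ 2 := by
    rw [← real_inner_self_eq_norm_sq, ← LinearMap.adjoint_inner_left, ← LinearMap.comp_apply,
      ← b.sum_inner_mul_inner]
    refine Finset.sum_congr rfl fun i _ => ?_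
    rw [hT, hb, hT.apply_eigenvectorBasis, inner_smul_right, real_inner_comm s]
    simp only [RCLike.ofReal_real_eq_id, id_eq]
    ring
  have hn (s : E) : ‖s‖ ^ 2 = ∑ i, inner ℝ (b i) s ^ 2 := (b.sum_sq_inner_right s).symm
  refine ⟨Submodule.span ℝ (Set.range fun i : {i // c ^ 2 < l i} => b i),
    Submodule.span ℝ (Set.range fun i : {i // ¬ c ^ 2 < l i} => b i), ?_, ?_, ?_⟩
  · rw [finrank_span_orthonormalBasis_subtype, finrank_span_orthonormalBasis_subtype,
      Fintype.card_subtype_compl, Nat.add_sub_cancel' (Fintype.card_subtype_le _),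
      Fintype.card_fin]
  · intro s hs h0
    refine lt_of_pow_lt_pow_left₀ 2 (norm_nonneg _) ?_
    rw [mul_pow, hM, hn, Finset.mul_sum]
    have key : ∀ i, c ^ 2 * inner ℝ (b i) s ^ 2 ≤ l i * inner ℝ (b i) s ^ 2 := fun i => by
      by_cases hi : c ^ 2 < l i
      · gcongr
      · simp [inner_orthonormalBasis_eq_zero_of_mem_span b _ hs hi]
    obtain ⟨i, hi⟩ : ∃ i, inner ℝ (b i) s ≠ 0 := by
      by_contra! h
      have := hn s
      simp [h, h0] at this
    refine Finset.sum_lt_sum (fun i _ => key i) ⟨i, Finset.mem_univ _, ?_⟩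
    have hi' : c ^ 2 < l i := by
      by_contra h
      exact hi (inner_orthonormalBasis_eq_zero_of_mem_span b _ hs h)
    gcongr
  · intro s hs
    refine le_of_sq_le_sq ?_ (by positivity)
    rw [mul_pow, hM, hn, Finset.mul_sum]
    refine Finset.sum_le_sum fun i _ => ?_
    by_cases hi : c ^ 2 < l i
    · have := inner_orthonormalBasis_eq_zero_of_mem_span b (fun i => ¬ c ^ 2 < l i) hs
        (j := i) (by simpa using hi)
      simp [this]
    · have := not_lt.1 hi
      gcongr

theorem exists_singular_split (M : E →ₗ[ℝ] G) (K : Submodule ℝ E) {c : ℝ} (hc : 0 ≤ c) :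
    ∃ S ≤ K, ∃ S' ≤ K,
      Module.finrank ℝ S + Module.finrank ℝ S' = Module.finrank ℝ K ∧
      (∀ s ∈ S, s ≠ 0 → c * ‖s‖ < ‖M s‖) ∧ ∀ s ∈ S', ‖M s‖ ≤ c * ‖s‖ := by
  obtain ⟨S, S', h, hS, hS'⟩ := exists_singular_split_top (M ∘ₗ K.subtype) hc
  refine ⟨S.map K.subtype, K.map_subtype_le S, S'.map K.subtype, K.map_subtype_le S', ?_, ?_, ?_⟩
  · rwa [Submodule.finrank_map_subtype_eq, Submodule.finrank_map_subtype_eq]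
  · rintro _ ⟨s, hs, rfl⟩ h0
    exact hS s hs fun h => h0 (by simp [h])
  · rintro _ ⟨s, hs, rfl⟩
    exact hS' s hs

theorem finrank_le_finrank_inf_add (K P Q : Submodule ℝ E) (hP : P ≤ K) (hQ : Q ≤ K) :
    Module.finrank ℝ P + Module.finrank ℝ Q ≤
      Module.finrank ℝ (P ⊓ Q : Submodule ℝ E) + Module.finrank ℝ K := by
  have h := Submodule.finrank_sup_add_finrank_inf_eq P Q
  have := Submodule.finrank_mono (sup_le hP hQ)
  omega

theorem finrank_le_finrank_finset_inf_add {κ : Type*} (K : Submodule ℝ E)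
    (P : κ → Submodule ℝ E) (hP : ∀ j, P j ≤ K) (d : ℕ)
    (hd : ∀ j, Module.finrank ℝ K ≤ Module.finrank ℝ (P j) + d) (s : Finset κ) :
    Module.finrank ℝ K ≤ Module.finrank ℝ (K ⊓ s.inf P : Submodule ℝ E) + s.card * d := by
  classical
  induction s using Finset.induction_on with
  | empty => rw [Finset.inf_empty, inf_top_eq]; simp
  | insert j s hj ih =>
    rw [Finset.inf_insert, Finset.card_insert_of_notMem hj, inf_left_comm]
    have := finrank_le_finrank_inf_add K (P j) (K ⊓ s.inf P) (hP j) inf_le_left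
    have := hd j
    linarith

/-- A family that is jointly bounded below on `K` has a member that is bounded below on a
proportional part of `K`. -/
theorem exists_finrank_large_of_sum_sq {n : ℕ} (hn : 0 < n) (A : Fin n → E →ₗ[ℝ] G)
    (K : Submodule ℝ E) {η : ℝ} (hη : 0 < η)
    (hK : ∀ w ∈ K, η ^ 2 * ‖w‖ ^ 2 ≤ ∑ j, ‖A j w‖ ^ 2) {d : ℕ}
    (hd : n * d < Module.finrank ℝ K) :
    ∃ j, ∃ S ≤ K, d < Module.finrank ℝ S ∧
      ∀ s ∈ S, s ≠ 0 → η / (2 * n) * ‖s‖ < ‖A j s‖ := by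
  by_contra! hcon
  have hn' : (1 : ℝ) ≤ n := by exact_mod_cast hn
  have hc : 0 ≤ η / (2 * n) := by positivity
  choose S hSK S' hS'K hdim hS hS' using fun j => exists_singular_split (A j) K hc
  have hSd : ∀ j, Module.finrank ℝ (S j) ≤ d := fun j => by
    by_contra! h
    obtain ⟨s, hs, h0, hlt⟩ := hcon j (S j) (hSK j) h
    exact absurd (hS j s hs h0) (not_lt.2 hlt)
  have h := finrank_le_finrank_finset_inf_add K S' hS'K d
    (fun j => by have := hdim j; have := hSd j; omega) Finset.univ
  rw [Finset.card_univ, Fintype.card_fin] at h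
  have hpos : 0 < Module.finrank ℝ (K ⊓ Finset.univ.inf S' : Submodule ℝ E) := by omega
  obtain ⟨u, hu, hu0⟩ := Submodule.exists_mem_ne_zero_of_ne_bot
    (Submodule.one_le_finrank_iff.1 hpos)
  have hle := hK u hu.1
  have hsum : ∑ j, ‖A j u‖ ^ 2 ≤ ∑ _j : Fin n, (η / (2 * n) * ‖u‖) ^ 2 := by
    refine Finset.sum_le_sum fun j _ => ?_
    have hj : u ∈ S' j := (Finset.inf_le (Finset.mem_univ j) : Finset.univ.inf S' ≤ S' j) hu.2
    exact pow_le_pow_left₀ (norm_nonneg _) (hS' j u hj) 2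
  have hu' : 0 < ‖u‖ ^ 2 := by positivity
  have : ∑ _j : Fin n, (η / (2 * n) * ‖u‖) ^ 2 = η ^ 2 * ‖u‖ ^ 2 / (4 * n) := by
    rw [Finset.sum_const, Finset.card_univ, Fintype.card_fin, nsmul_eq_mul]
    field_simp
    ring
  have hX : 0 < η ^ 2 * ‖u‖ ^ 2 := by positivity
  have : η ^ 2 * ‖u‖ ^ 2 / (4 * n) < η ^ 2 * ‖u‖ ^ 2 := by
    rw [div_lt_iff₀ (by positivity)]
    nlinarith
  linarith

end LinearAlgebra

section Measure

theorem pi_inter_le_mul {κ : Type*} [Fintype κ] [DecidableEq κ] (μ : κ → Measure ℝ)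
    [∀ i, IsProbabilityMeasure (μ i)] {A B : Set (κ → ℝ)} (hA : MeasurableSet A)
    (hB : MeasurableSet B) (j : κ) {q : ENNReal}
    (hAq : ∀ y, μ j {s | Function.update y j s ∈ A} ≤ q)
    (hBj : ∀ y s, Function.update y j s ∈ B → y ∈ B) :
    Measure.pi μ (A ∩ B) ≤ q * Measure.pi μ B := by
  have hBj' : ∀ y s, Function.update y j s ∈ B ↔ y ∈ B := fun y s =>
    ⟨hBj y s, fun h => hBj _ (y j) (by simpa using h)⟩
  rw [← lintegral_indicator_one (hA.inter hB), ← lintegral_indicator_one hB,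
    ← lintegral_const_mul _ (measurable_one.indicator hB)]
  refine lintegral_le_of_lmarginal_le {j} (measurable_one.indicator (hA.inter hB))
    ((measurable_one.indicator hB).const_mul q) fun y => ?_
  rw [lmarginal_singleton, lmarginal_singleton]
  by_cases hy : y ∈ B
  · have h1 (s : ℝ) : (A ∩ B).indicator (1 : (κ → ℝ) → ENNReal) (Function.update y j s) =
        {s | Function.update y j s ∈ A}.indicator 1 s := by
      by_cases hs : Function.update y j s ∈ A <;> simp [hs, hBj', hy]
    have h2 (s : ℝ) : B.indicator (1 : (κ → ℝ) → ENNReal) (Function.update y j s) = 1 := by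
      simp [hBj', hy]
    simp only [h1, h2]
    have hAy : MeasurableSet {s | Function.update y j s ∈ A} := measurable_update y hA
    rw [lintegral_indicator_one hAy]
    simpa using hAq y
  · have h1 (s : ℝ) : (A ∩ B).indicator (1 : (κ → ℝ) → ENNReal) (Function.update y j s) = 0 := by
      simp [hBj', hy]
    simp [h1]

theorem gaussianReal_le_of_forall_abs_sub_le {m : ℝ} {v : NNReal} (hv : v ≠ 0) {h : ℝ}
    {A : Set ℝ} (hA : ∀ y ∈ A, ∀ y' ∈ A, |y - y'| ≤ h) :
    gaussianReal m v A ≤ ENNReal.ofReal (h / √v) := by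
  rcases A.eq_empty_or_nonempty with rfl | ⟨a, ha⟩
  · simp
  have hh : 0 ≤ h := (abs_nonneg _).trans (hA a ha a ha)
  have hv' : 0 < (v : ℝ) := by positivity
  have hpdf (y : ℝ) : gaussianPDF m v y ≤ ENNReal.ofReal (√v)⁻¹ := by
    refine ENNReal.ofReal_le_ofReal ?_
    rw [gaussianPDFReal]
    have h1 : Real.exp (-(y - m) ^ 2 / (2 * v)) ≤ 1 := by
      rw [Real.exp_le_one_iff, neg_div]
      exact neg_nonpos.2 (by positivity)
    have h2 : (√(2 * Real.pi * v))⁻¹ ≤ (√v)⁻¹ := by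
      refine inv_anti₀ (by positivity) (Real.sqrt_le_sqrt ?_)
      nlinarith [Real.pi_gt_three]
    calc _ ≤ (√(2 * Real.pi * v))⁻¹ * 1 := by gcongr
      _ ≤ _ := by simpa using h2
  have hdiam : volume A ≤ ENNReal.ofReal h := by
    refine (Real.volume_le_diam A).trans (Metric.ediam_le fun y hy y' hy' => ?_)
    rw [edist_dist, Real.dist_eq]
    exact ENNReal.ofReal_le_ofReal (hA y hy y' hy')
  rw [gaussianReal_apply m hv]
  calc _ ≤ ∫⁻ _ in A, ENNReal.ofReal (√v)⁻¹ := lintegral_mono hpdf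
    _ = ENNReal.ofReal (√v)⁻¹ * volume A := by simp
    _ ≤ ENNReal.ofReal (√v)⁻¹ * ENNReal.ofReal h := by gcongr
    _ = _ := by rw [← ENNReal.ofReal_mul (by positivity), div_eq_inv_mul]

end Measure

section Good

variable {E G : Type*} [NormedAddCommGroup E] [InnerProductSpace ℝ E]
  [NormedAddCommGroup G] [InnerProductSpace ℝ G]

/-- `K` has a subspace of dimension at least `m` on which `M` expands norms by more than `ε`. -/
def ExpandsOn (M : E →ₗ[ℝ] G) (K : Submodule ℝ E) (m : ℕ) (ε : ℝ) : Prop :=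
  ∃ S ≤ K, m ≤ Module.finrank ℝ S ∧ ∀ s ∈ S, s ≠ 0 → ε * ‖s‖ < ‖M s‖

theorem ExpandsOn.mono {M : E →ₗ[ℝ] G} {K K' : Submodule ℝ E} {m : ℕ} {ε : ℝ}
    (h : ExpandsOn M K m ε) (hK : K ≤ K') : ExpandsOn M K' m ε := by
  obtain ⟨S, hS, h⟩ := h
  exact ⟨S, hS.trans hK, h⟩

theorem ExpandsOn.congr {M M' : E →ₗ[ℝ] G} {K : Submodule ℝ E} {m : ℕ} {ε : ℝ}
    (h : ExpandsOn M K m ε) (hM : ∀ s ∈ K, M s = M' s) : ExpandsOn M' K m ε := by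
  obtain ⟨S, hS, hm, h⟩ := h
  exact ⟨S, hS, hm, fun s hs h0 => hM s (hS hs) ▸ h s hs h0⟩

variable [FiniteDimensional ℝ E]

theorem isOpen_setOf_expandsOn {X : Type*} [TopologicalSpace X] (M : X → E →ₗ[ℝ] G)
    (hM : Continuous fun p : X × E => M p.1 p.2) (K : Submodule ℝ E) (m : ℕ) (ε : ℝ) :
    IsOpen {g | ExpandsOn (M g) K m ε} := by
  have hS (S : Submodule ℝ E) : IsOpen {g | ∀ s ∈ S, s ≠ 0 → ε * ‖s‖ < ‖M g s‖} := by
    have hcomp : IsCompact ((S : Set E) ∩ Metric.sphere 0 1) :=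
      (isCompact_sphere 0 1).inter_left S.closed_of_finiteDimensional
    have heq : {g | ∀ s ∈ S, s ≠ 0 → ε * ‖s‖ < ‖M g s‖} =
        {g | ∀ s ∈ (S : Set E) ∩ Metric.sphere 0 1, ε * ‖s‖ < ‖M g s‖} := by
      ext g
      refine ⟨fun h s hs => h s hs.1 ?_, fun h s hs h0 => ?_⟩
      · rintro rfl
        simpa using hs.2
      · have hs0 : 0 < ‖s‖ := norm_pos_iff.2 h0
        have := h (‖s‖⁻¹ • s) ⟨S.smul_mem _ hs, by simp [norm_smul, hs0.ne']⟩
        rw [map_smul, norm_smul, norm_smul, norm_inv, norm_norm] at this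
        have := mul_lt_mul_of_pos_left this hs0
        field_simp at this
        linarith
    rw [heq, isOpen_iff_mem_nhds]
    intro g hg
    refine hcomp.eventually_forall_of_forall_eventually fun s hs => ?_
    have hopen : IsOpen {p : X × E | ε * ‖p.2‖ < ‖M p.1 p.2‖} :=
      isOpen_lt (by fun_prop) hM.norm
    exact hopen.mem_nhds (hg s hs)
  have : {g | ExpandsOn (M g) K m ε} = ⋃ S : Submodule ℝ E, ⋃ _ : S ≤ K,
      ⋃ _ : m ≤ Module.finrank ℝ S, {g | ∀ s ∈ S, s ≠ 0 → ε * ‖s‖ < ‖M g s‖} := by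
    ext g
    simp only [ExpandsOn, Set.mem_iUnion, Set.mem_ofPred_eq, exists_prop]
  rw [this]
  exact isOpen_iUnion fun S => isOpen_iUnion fun _ => isOpen_iUnion fun _ => hS S

theorem continuous_sum_smul_apply {n : ℕ} (A : Fin n → E →ₗ[ℝ] G) (x : Fin n → ℝ) :
    Continuous fun p : (Fin n → ℝ) × E => (∑ j, (x j + p.1 j) • A j) p.2 := by
  have hA (j : Fin n) : Continuous (A j) := (A j).continuous_of_finiteDimensional
  simp only [LinearMap.sum_apply, LinearMap.smul_apply]
  fun_prop

variable [FiniteDimensional ℝ G]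

theorem exists_of_not_expandsOn {M : E →ₗ[ℝ] G} {K : Submodule ℝ E} {m : ℕ} {ε : ℝ} (hε : 0 ≤ ε)
    (h : ¬ ExpandsOn M K m ε) :
    ∃ S ≤ K, Module.finrank ℝ K < Module.finrank ℝ S + m ∧ ∀ s ∈ S, ‖M s‖ ≤ ε * ‖s‖ := by
  obtain ⟨S, hS, S', hS', hdim, hlt, hle⟩ := exists_singular_split M K hε
  have : Module.finrank ℝ S < m := by
    by_contra! hm
    exact h ⟨S, hS, hm, hlt⟩
  exact ⟨S', hS', by omega, hle⟩

/-- Along a direction in which `A` expands, the parameters where expansion fails on half of `K`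
lie in a short interval. -/
theorem abs_le_of_not_expandsOn {M M' A : E →ₗ[ℝ] G} {K : Submodule ℝ E} {m : ℕ} {θ ε y : ℝ}
    (hθ : 0 < θ) (hε : 0 ≤ ε) (hA : ∀ s ∈ K, s ≠ 0 → θ * ‖s‖ < ‖A s‖)
    (hm : 2 * m - 2 < Module.finrank ℝ K) (hM : M - M' = y • A)
    (h : ¬ ExpandsOn M K m ε) (h' : ¬ ExpandsOn M' K m ε) : |y| ≤ 2 * ε / θ := by
  obtain ⟨S, hS, hdim, hle⟩ := exists_of_not_expandsOn hε h
  obtain ⟨S', hS', hdim', hle'⟩ := exists_of_not_expandsOn hε h'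
  have := finrank_le_finrank_inf_add K S S' hS hS'
  obtain ⟨s, hs, h0⟩ := Submodule.exists_mem_ne_zero_of_ne_bot
    (Submodule.one_le_finrank_iff.1 (by omega : 1 ≤ Module.finrank ℝ (S ⊓ S' : Submodule ℝ E)))
  have hs0 : 0 < ‖s‖ := norm_pos_iff.2 h0
  have hsub : ‖y • A s‖ ≤ 2 * ε * ‖s‖ := by
    rw [← LinearMap.smul_apply, ← hM, LinearMap.sub_apply]
    linarith [norm_sub_le (M s) (M' s), hle s hs.1, hle' s hs.2]
  rw [norm_smul, Real.norm_eq_abs] at hsub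
  have hAs := hA s (hS hs.1) h0
  rw [le_div_iff₀ hθ]
  refine le_of_mul_le_mul_right ?_ hs0
  nlinarith [abs_nonneg y]

theorem finrank_le_finrank_inf_ker_add (A : E →ₗ[ℝ] G) (K : Submodule ℝ E) :
    Module.finrank ℝ K ≤
      Module.finrank ℝ (K ⊓ LinearMap.ker A : Submodule ℝ E) + Module.finrank ℝ G := by
  have h := (A ∘ₗ K.subtype).finrank_range_add_finrank_ker
  have h1 := Submodule.finrank_le (LinearMap.range (A ∘ₗ K.subtype))
  have h2 : (LinearMap.ker (A ∘ₗ K.subtype)).map K.subtype = K ⊓ LinearMap.ker A := by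
    rw [LinearMap.ker_comp, Submodule.map_comap_subtype]
  have h3 := Submodule.finrank_map_subtype_eq K (LinearMap.ker (A ∘ₗ K.subtype))
  rw [h2] at h3
  omega

/-- A random combination of maps that are jointly bounded below on `K` expands on a proportional
part of `K`, except with exponentially small probability. -/
theorem pi_not_expandsOn_le {n : ℕ} (hn : 0 < n) (μ : Fin n → Measure ℝ)
    [∀ j, IsProbabilityMeasure (μ j)] (A : Fin n → E →ₗ[ℝ] G) (x : Fin n → ℝ) {η ε : ℝ}
    (hη : 0 < η) (hε : 0 ≤ ε) {m : ℕ} {q : ENNReal}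
    (hμ : ∀ j, ∀ B : Set ℝ, (∀ y ∈ B, ∀ y' ∈ B, |y - y'| ≤ 4 * n * ε / η) → μ j B ≤ q)
    (L : ℕ) (K : Submodule ℝ E) (hK : ∀ w ∈ K, η ^ 2 * ‖w‖ ^ 2 ≤ ∑ j, ‖A j w‖ ^ 2)
    (hdim : n * (2 * m - 2) + L * Module.finrank ℝ G <
      Module.finrank ℝ K + Module.finrank ℝ G) :
    Measure.pi μ {g | ¬ ExpandsOn (∑ j, (x j + g j) • A j) K m ε} ≤ q ^ L := by
  have hmeas (K : Submodule ℝ E) :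
      MeasurableSet {g : Fin n → ℝ | ¬ ExpandsOn (∑ j, (x j + g j) • A j) K m ε} :=
    (isOpen_setOf_expandsOn _ (continuous_sum_smul_apply A x) K m ε).measurableSet.compl
  induction L generalizing K with
  | zero => simpa using prob_le_one
  | succ L ih =>
    rw [add_mul, one_mul] at hdim
    obtain ⟨j, S, hSK, hSd, hS⟩ := exists_finrank_large_of_sum_sq hn A K hη hK
      (d := 2 * m - 2) (by omega)
    set K' := K ⊓ LinearMap.ker (A j) with hK'
    have hdim' : Module.finrank ℝ K ≤ Module.finrank ℝ K' + Module.finrank ℝ G :=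
      finrank_le_finrank_inf_ker_add (A j) K
    have ih' := ih K' (fun w hw => hK w hw.1) (by omega)
    have hupd (g : Fin n → ℝ) (s : ℝ) :
        ∑ i, (x i + Function.update g j s i) • A i =
          ∑ i, (x i + g i) • A i + (s - g j) • A j := by
      rw [← sub_eq_iff_eq_add', ← Finset.sum_sub_distrib, Finset.sum_eq_single j]
      · rw [← sub_smul]; simp
      · intro i _ hi
        simp [Function.update_of_ne hi]
      · simp
    calc Measure.pi μ {g | ¬ ExpandsOn (∑ j, (x j + g j) • A j) K m ε}
        ≤ Measure.pi μ ({g | ¬ ExpandsOn (∑ j, (x j + g j) • A j) S m ε} ∩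
            {g | ¬ ExpandsOn (∑ j, (x j + g j) • A j) K' m ε}) :=
          measure_mono fun g hg => ⟨fun h => hg (h.mono hSK), fun h => hg (h.mono inf_le_left)⟩
      _ ≤ q * Measure.pi μ {g | ¬ ExpandsOn (∑ j, (x j + g j) • A j) K' m ε} := by
          refine pi_inter_le_mul μ (hmeas S) (hmeas K') j (fun g => hμ j _ ?_) ?_
          · intro y hy y' hy'
            have hn' : (0 : ℝ) < n := by exact_mod_cast hn
            have := abs_le_of_not_expandsOn (y := y - y') (by positivity) hε hS hSd
              (by rw [hupd, hupd, add_sub_add_left_eq_sub, ← sub_smul, sub_sub_sub_cancel_right])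
              hy hy'
            refine this.trans_eq ?_
            field_simp
            ring
          · intro g s hg h
            refine hg (h.congr fun w hw => ?_)
            have : A j w = 0 := hw.2
            rw [hupd]
            simp [this]
      _ ≤ q * q ^ L := by gcongr
      _ = q ^ (L + 1) := (pow_succ' q L).symm

end Good

section Tensor

variable {F : Type*} [NormedAddCommGroup F] [InnerProductSpace ℝ F]

/-- The map sending `w` to the vector of inner products of `w` with a finite family. -/
def innerFamily {ι : Type*} [Fintype ι] (t : ι → F) : F →ₗ[ℝ] EuclideanSpace ℝ ι :=
  (WithLp.linearEquiv 2 ℝ (ι → ℝ)).symm.toLinearMap ∘ₗ LinearMap.pi fun i => innerₗ F (t i)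

@[simp]
theorem innerFamily_apply {ι : Type*} [Fintype ι] (t : ι → F) (w : F) (i : ι) :
    innerFamily t w i = inner ℝ (t i) w := rfl

theorem norm_innerFamily_sq {ι : Type*} [Fintype ι] (t : ι → F) (w : F) :
    ‖innerFamily t w‖ ^ 2 = ∑ i, inner ℝ (t i) w ^ 2 := by
  simp [EuclideanSpace.norm_sq_eq]

/-- The slices of an `F`-valued tensor along its first mode. -/
def slice {n ℓ : ℕ} (t : (Fin (ℓ + 1) → Fin n) → F) (j : Fin n) : (Fin ℓ → Fin n) → F :=
  fun f => t (Fin.cons j f)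

/-- The value of an `F`-valued tensor at a product vector. -/
def prodEval {n ℓ : ℕ} (t : (Fin ℓ → Fin n) → F) (y : Fin ℓ → Fin n → ℝ) : F :=
  ∑ f, (∏ i, y i (f i)) • t f

theorem sum_fin_cons {M : Type*} [AddCommMonoid M] {n ℓ : ℕ} (φ : (Fin (ℓ + 1) → Fin n) → M) :
    ∑ f, φ f = ∑ j, ∑ f : Fin ℓ → Fin n, φ (Fin.cons j f) := by
  rw [← (Fin.consEquiv fun _ => Fin n).sum_comp, Fintype.sum_prod_type]
  rfl

theorem prodEval_succ {n ℓ : ℕ} (t : (Fin (ℓ + 1) → Fin n) → F) (y : Fin (ℓ + 1) → Fin n → ℝ) :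
    prodEval t y = prodEval (∑ j, y 0 j • slice t j) fun i => y i.succ := by
  rw [prodEval, sum_fin_cons, prodEval]
  simp only [Finset.sum_apply, Pi.smul_apply, Finset.smul_sum, Fin.prod_univ_succ,
    Fin.cons_zero, Fin.cons_succ, slice]
  rw [Finset.sum_comm]
  simp only [smul_smul, mul_comm]

theorem norm_innerFamily_sq_eq_sum_slice {n ℓ : ℕ} (t : (Fin (ℓ + 1) → Fin n) → F) (w : F) :
    ‖innerFamily t w‖ ^ 2 = ∑ j, ‖innerFamily (slice t j) w‖ ^ 2 := by
  simp only [norm_innerFamily_sq, sum_fin_cons (fun f => inner ℝ (t f) w ^ 2), slice]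

theorem sum_smul_innerFamily_slice {n ℓ : ℕ} (t : (Fin (ℓ + 1) → Fin n) → F) (y : Fin n → ℝ) :
    ∑ j, y j • innerFamily (slice t j) = innerFamily (∑ j, y j • slice t j) := by
  ext w f
  simp [LinearMap.sum_apply, sum_inner, real_inner_smul_left]

theorem continuous_prodEval {n ℓ : ℕ} (t : (Fin ℓ → Fin n) → F) : Continuous (prodEval t) := by
  unfold prodEval
  fun_prop

instance {n : ℕ} {ρ : ℝ} : IsProbabilityMeasure (gaussianVec n ρ) := by
  unfold gaussianVec
  infer_instance

theorem gaussianReal_perturbation_le {n : ℕ} (hn : 0 < n) {ρ q η : ℝ} (hρ : 0 < ρ) (hq : 0 < q)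
    (hη : 0 < η) {B : Set ℝ}
    (hB : ∀ y ∈ B, ∀ y' ∈ B, |y - y'| ≤ 4 * n * (η * (q * ρ / (4 * n ^ 2))) / η) :
    gaussianReal 0 (Real.toNNReal (ρ ^ 2 / n)) B ≤ ENNReal.ofReal q := by
  have hn' : (1 : ℝ) ≤ n := by exact_mod_cast hn
  have hv : 0 < ρ ^ 2 / n := by positivity
  refine (gaussianReal_le_of_forall_abs_sub_le (by simpa using hv) hB).trans
    (ENNReal.ofReal_le_ofReal ?_)
  rw [Real.coe_toNNReal _ hv.le, Real.sqrt_div (by positivity), Real.sqrt_sq hρ.le]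
  have hsq : √(n : ℝ) * √n = n := Real.mul_self_sqrt (by positivity)
  have hs : 1 ≤ √(n : ℝ) := Real.one_le_sqrt.2 hn'
  rw [div_le_iff₀ (by positivity)]
  have : 4 * n * (η * (q * ρ / (4 * n ^ 2))) / η = q * (ρ / n) := by
    field_simp
  rw [this]
  gcongr
  nlinarith

variable [FiniteDimensional ℝ F]

/-- Anticoncentration of a vector-valued tensor at a randomly perturbed product vector. -/
theorem pi_norm_prodEval_lt_le {n : ℕ} (hn : 0 < n) {ρ q : ℝ} (hρ : 0 < ρ) (hq : 0 < q) (a ℓ : ℕ)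
    (t : (Fin ℓ → Fin n) → F) (x : Fin ℓ → Fin n → ℝ) (K : Submodule ℝ F) {δ η : ℝ}
    (hδ : 0 < δ) (hη : 0 < η) (hdim : δ * n ^ ℓ ≤ Module.finrank ℝ K)
    (ha : (a : ℝ) ≤ δ * n / (2 * 4 ^ ℓ) + 1) (hK : ∀ w ∈ K, η * ‖w‖ ≤ ‖innerFamily t w‖) :
    (Measure.pi fun _ : Fin ℓ => gaussianVec n ρ)
      {g | ‖prodEval t (x + g)‖ < η * (q * ρ / (4 * n ^ 2)) ^ ℓ} ≤
        ℓ * ENNReal.ofReal q ^ a := by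
  have hn' : (1 : ℝ) ≤ n := by exact_mod_cast hn
  induction ℓ generalizing K δ η with
  | zero =>
    have hpos : 0 < Module.finrank ℝ K := by
      have : (0 : ℝ) < Module.finrank ℝ K := lt_of_lt_of_le (by positivity) hdim
      exact_mod_cast this
    obtain ⟨w, hw, hw0⟩ := Submodule.exists_mem_ne_zero_of_ne_bot
      (Submodule.one_le_finrank_iff.1 hpos)
    have hle := hK w hw
    have hw' : 0 < ‖w‖ := norm_pos_iff.2 hw0
    have hemp : {g : Fin 0 → Fin n → ℝ |
        ‖prodEval t (x + g)‖ < η * (q * ρ / (4 * n ^ 2)) ^ 0} = ∅ := by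
      refine Set.eq_empty_of_forall_notMem fun g hg => ?_
      have hg' : ‖t default‖ < η := by simpa [prodEval] using hg
      have hnorm : ‖innerFamily t w‖ = |inner ℝ (t default) w| := by
        rw [← Real.sqrt_sq (norm_nonneg _), norm_innerFamily_sq, Fintype.sum_unique,
          Real.sqrt_sq_eq_abs]
      have := abs_real_inner_le_norm (t default) w
      nlinarith
    rw [hemp, measure_empty]
    exact zero_le
  | succ ℓ ih =>
    set ε := η * (q * ρ / (4 * n ^ 2)) with hε
    have hε0 : 0 < ε := by positivity
    set m := ⌈δ * n ^ ℓ / 4⌉₊ with hm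
    have hm1 : 0 < m := Nat.ceil_pos.2 (by positivity)
    have hmle : δ / 4 * n ^ ℓ ≤ m := by
      have := Nat.le_ceil (δ * n ^ ℓ / 4)
      linarith
    have hmlt : (m : ℝ) < δ * n ^ ℓ / 4 + 1 := Nat.ceil_lt_add_one (by positivity)
    have ha' : (a : ℝ) ≤ δ / 4 * n / (2 * 4 ^ ℓ) + 1 := by
      refine ha.trans_eq ?_
      rw [pow_succ]
      field_simp
    set Bad : Set (Fin n → ℝ) := {g | ¬ ExpandsOn
      (∑ j, (x 0 j + g j) • innerFamily (slice t j)) K m ε} with hBad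
    have hBadm : MeasurableSet Bad :=
      (isOpen_setOf_expandsOn _ (continuous_sum_smul_apply _ (x 0)) K m ε).measurableSet.compl
    have hBadle : gaussianVec n ρ Bad ≤ ENNReal.ofReal q ^ a := by
      refine pi_not_expandsOn_le hn _ (fun j => innerFamily (slice t j)) (x 0) hη hε0.le
        (fun j B hB => gaussianReal_perturbation_le hn hρ hq hη hB) a K (fun w hw => ?_) ?_
      · rw [← norm_innerFamily_sq_eq_sum_slice, ← mul_pow]
        exact pow_le_pow_left₀ (by positivity) (hK w hw) 2
      · rw [finrank_euclideanSpace, Fintype.card_fun, Fintype.card_fin, Fintype.card_fin]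
        have h2m : ((2 * m - 2 : ℕ) : ℝ) = 2 * m - 2 := by
          rw [Nat.cast_sub (by omega)]
          push_cast
          ring
        have h1 : (n : ℝ) * (2 * m - 2) < δ * n ^ (ℓ + 1) / 2 := by
          rw [pow_succ]
          nlinarith
        have h2 : ((a : ℝ) - 1) * n ^ ℓ ≤ δ * n ^ (ℓ + 1) / 2 := by
          have h4 : (1 : ℝ) ≤ 4 ^ (ℓ + 1) := one_le_pow₀ (by norm_num)
          have : (a : ℝ) - 1 ≤ δ * n / 2 := by
            calc (a : ℝ) - 1 ≤ δ * n / (2 * 4 ^ (ℓ + 1)) := by linarith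
              _ ≤ δ * n / 2 := by gcongr; linarith
          calc ((a : ℝ) - 1) * n ^ ℓ ≤ δ * n / 2 * n ^ ℓ := by gcongr
            _ = _ := by ring
        have : (n : ℝ) * ((2 * m - 2 : ℕ) : ℝ) + a * n ^ ℓ < Module.finrank ℝ K + n ^ ℓ := by
          rw [h2m]
          linarith
        exact_mod_cast this
    set P := Measure.pi fun _ : Fin ℓ => gaussianVec n ρ with hP
    set c : ℝ := η * (q * ρ / (4 * n ^ 2)) ^ (ℓ + 1) with hc
    set D : Set ((Fin n → ℝ) × (Fin ℓ → Fin n → ℝ)) :=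
      {p | ‖prodEval (∑ j, (x 0 j + p.1 j) • slice t j) ((fun i => x i.succ) + p.2)‖ < c} with hD
    have hpre : {g : Fin (ℓ + 1) → Fin n → ℝ | ‖prodEval t (x + g)‖ < c} =
        (MeasurableEquiv.piFinSuccAbove (fun _ => Fin n → ℝ) 0) ⁻¹' D := by
      ext g
      rw [Set.mem_ofPred_eq, prodEval_succ]
      rfl
    have hDm : MeasurableSet D := by
      refine (isOpen_lt ?_ continuous_const).measurableSet
      unfold prodEval
      simp only [Finset.sum_apply, Pi.smul_apply]
      fun_prop
    have hsec (y : Fin n → ℝ) : P (Prod.mk y ⁻¹' D) ≤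
        ℓ * ENNReal.ofReal q ^ a + Bad.indicator 1 y := by
      by_cases hy : y ∈ Bad
      · simpa [hy] using prob_le_one.trans le_add_self
      · obtain ⟨S, hSK, hSm, hS⟩ := not_not.1 hy
        have := ih (∑ j, (x 0 j + y j) • slice t j) (fun i => x i.succ) S (δ := δ / 4) (η := ε)
          (by positivity) hε0 (hmle.trans (by exact_mod_cast hSm)) ha' fun w hw => by
            rcases eq_or_ne w 0 with rfl | hw0
            · simp
            · have := (hS w hw hw0).le
              rwa [sum_smul_innerFamily_slice t (fun j => x 0 j + y j)] at this
        have hc' : ε * (q * ρ / (4 * n ^ 2)) ^ ℓ = c := by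
          rw [hc, hε, pow_succ]
          ring
        rw [hc'] at this
        rw [Set.indicator_of_notMem hy, add_zero]
        exact this
    rw [hpre, (measurePreserving_piFinSuccAbove (fun _ : Fin (ℓ + 1) => gaussianVec n ρ)
      0).measure_preimage hDm.nullMeasurableSet, Measure.prod_apply hDm]
    calc ∫⁻ y, P (Prod.mk y ⁻¹' D) ∂gaussianVec n ρ
        ≤ ∫⁻ y, (ℓ * ENNReal.ofReal q ^ a + Bad.indicator 1 y) ∂gaussianVec n ρ :=
          lintegral_mono hsec
      _ = ℓ * ENNReal.ofReal q ^ a + gaussianVec n ρ Bad := by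
          rw [lintegral_add_left measurable_const, lintegral_indicator_one hBadm]
          simp
      _ ≤ ℓ * ENNReal.ofReal q ^ a + ENNReal.ofReal q ^ a := by gcongr
      _ = _ := by push_cast; ring

end Tensor

section SingularValue

theorem enorm2_eq_norm {ι : Type*} [Fintype ι] (x : ι → ℝ) :
    enorm2 x = ‖(WithLp.toLp 2 x : EuclideanSpace ℝ ι)‖ := by
  simp [enorm2, EuclideanSpace.norm_eq]

/-- The columns of a matrix, as vectors of Euclidean space. -/
def euclideanCol {ι κ : Type*} (T : Matrix ι κ ℝ) (f : κ) : EuclideanSpace ℝ ι :=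
  WithLp.toLp 2 fun i => T i f

theorem sum_smul_euclideanCol {ι κ : Type*} [Fintype κ] (T : Matrix ι κ ℝ)
    (v : κ → ℝ) : ∑ f, v f • euclideanCol T f = WithLp.toLp 2 (T.mulVec v) := by
  ext i
  simp [euclideanCol, Matrix.mulVec, dotProduct, mul_comm]

theorem inner_mulVec {ι κ : Type*} [Fintype ι] [Fintype κ] (T : Matrix ι κ ℝ) (v : κ → ℝ)
    (w : EuclideanSpace ℝ ι) :
    inner ℝ (WithLp.toLp 2 (T.mulVec v)) w =
      inner ℝ (WithLp.toLp 2 v) (innerFamily (euclideanCol T) w) := by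
  rw [← sum_smul_euclideanCol, sum_inner, PiLp.inner_apply]
  refine Finset.sum_congr rfl fun f _ => ?_
  simp [real_inner_smul_left, mul_comm]

/-- A lower bound on the `k`-th singular value makes the transpose bounded below on a
`k`-dimensional subspace. -/
theorem exists_subspace_of_le_singVal {ι κ : Type*} [Fintype ι] [Fintype κ] (T : Matrix ι κ ℝ)
    {k : ℕ} {η : ℝ} (hη : 0 < η) (h : η ≤ singVal T k) :
    ∃ K : Submodule ℝ (EuclideanSpace ℝ ι), Module.finrank ℝ K = k ∧
      ∀ w ∈ K, η / 2 * ‖w‖ ≤ ‖innerFamily (euclideanCol T) w‖ := by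
  have hlt : η / 2 < singVal T k := by linarith
  have hne : {s : ℝ | ∃ V : Submodule ℝ (κ → ℝ), Module.finrank ℝ V = k ∧
      s = sInf {t : ℝ | ∃ x ∈ V, enorm2 x = 1 ∧ t = enorm2 (T.mulVec x)}}.Nonempty := by
    by_contra hempty
    rw [Set.not_nonempty_iff_eq_empty] at hempty
    rw [singVal, hempty, Real.sSup_empty] at hlt
    linarith
  obtain ⟨s, ⟨V, hVk, rfl⟩, hs⟩ := exists_lt_of_lt_csSup hne hlt
  have hunit : ∀ v ∈ V, enorm2 v = 1 → η / 2 ≤ enorm2 (T.mulVec v) := fun v hv h1 =>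
    hs.le.trans (csInf_le ⟨0, by rintro _ ⟨x, -, -, rfl⟩; exact Real.sqrt_nonneg _⟩
      ⟨v, hv, h1, rfl⟩)
  have hV : ∀ v ∈ V, η / 2 * enorm2 v ≤ enorm2 (T.mulVec v) := fun v hv => by
    rcases eq_or_ne v 0 with rfl | h0
    · simp [enorm2]
    have hpos : 0 < enorm2 v := by
      rw [enorm2_eq_norm]
      exact norm_pos_iff.2 (by simpa using h0)
    have := hunit ((enorm2 v)⁻¹ • v) (V.smul_mem _ hv) (by
      rw [enorm2_eq_norm, WithLp.toLp_smul, norm_smul, ← enorm2_eq_norm, norm_inv,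
        Real.norm_of_nonneg hpos.le, inv_mul_cancel₀ hpos.ne'])
    rw [Matrix.mulVec_smul, enorm2_eq_norm, WithLp.toLp_smul, norm_smul, ← enorm2_eq_norm,
      norm_inv, Real.norm_of_nonneg hpos.le, ← div_eq_inv_mul, le_div_iff₀ hpos] at this
    exact this
  set Φ : (κ → ℝ) →ₗ[ℝ] EuclideanSpace ℝ ι :=
    (WithLp.linearEquiv 2 ℝ (ι → ℝ)).symm.toLinearMap ∘ₗ T.mulVecLin with hΦ
  have hΦv (v : κ → ℝ) : Φ v = WithLp.toLp 2 (T.mulVec v) := rfl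
  refine ⟨LinearMap.range (Φ.domRestrict V), ?_, ?_⟩
  · rw [← hVk]
    refine LinearMap.finrank_range_of_inj (LinearMap.ker_eq_bot.1 (LinearMap.ker_eq_bot'.2 ?_))
    rintro ⟨v, hv⟩ h0
    replace h0 : Φ v = 0 := h0
    have := hV v hv
    rw [enorm2_eq_norm, enorm2_eq_norm, ← hΦv, h0, norm_zero] at this
    have hn : ‖(WithLp.toLp 2 v : EuclideanSpace ℝ κ)‖ = 0 :=
      le_antisymm (by nlinarith) (norm_nonneg _)
    simpa using hn
  · rintro _ ⟨⟨v, hv⟩, rfl⟩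
    change η / 2 * ‖Φ v‖ ≤ ‖innerFamily (euclideanCol T) (Φ v)‖
    rcases eq_or_ne (Φ v) 0 with h0 | h0
    · simp [h0]
    have hvn := hV v hv
    rw [enorm2_eq_norm, enorm2_eq_norm, ← hΦv] at hvn
    have hinner : ‖Φ v‖ ^ 2 ≤
        ‖(WithLp.toLp 2 v : EuclideanSpace ℝ κ)‖ * ‖innerFamily (euclideanCol T) (Φ v)‖ := by
      rw [← real_inner_self_eq_norm_sq]
      nth_rewrite 1 [hΦv]
      rw [inner_mulVec]
      exact real_inner_le_norm _ _
    have hpos : 0 < ‖Φ v‖ := norm_pos_iff.2 h0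
    refine le_of_mul_le_mul_right ?_ hpos
    calc η / 2 * ‖Φ v‖ * ‖Φ v‖ = η / 2 * ‖Φ v‖ ^ 2 := by ring
      _ ≤ η / 2 * (‖(WithLp.toLp 2 v : EuclideanSpace ℝ κ)‖ *
          ‖innerFamily (euclideanCol T) (Φ v)‖) := by gcongr
      _ = η / 2 * ‖(WithLp.toLp 2 v : EuclideanSpace ℝ κ)‖ *
          ‖innerFamily (euclideanCol T) (Φ v)‖ := by ring
      _ ≤ ‖Φ v‖ * ‖innerFamily (euclideanCol T) (Φ v)‖ := by gcongr
      _ = _ := mul_comm _ _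

end SingularValue

section Numerics

theorem exponent_le {ℓ : ℕ} (hℓ : 0 < ℓ) : 1 + (4 ^ (ℓ + 2) + 4) * ℓ ≤ 3 ^ (6 * ℓ) := by
  have h2 : ℓ ≤ 2 ^ ℓ := Nat.lt_two_pow_self.le
  have h4 : 1 ≤ 4 ^ ℓ := Nat.one_le_pow _ _ (by norm_num)
  have h21 : 21 ≤ 21 ^ ℓ := Nat.le_self_pow hℓ.ne' 21
  calc 1 + (4 ^ (ℓ + 2) + 4) * ℓ ≤ 2 ^ ℓ * 4 ^ ℓ + (20 * 4 ^ ℓ) * 2 ^ ℓ := by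
        refine Nat.add_le_add (by nlinarith) (Nat.mul_le_mul ?_ h2)
        rw [pow_add]
        omega
    _ = 21 * (2 * 4) ^ ℓ := by rw [mul_pow]; ring
    _ ≤ 21 ^ ℓ * (2 * 4) ^ ℓ := by gcongr
    _ = 168 ^ ℓ := by rw [← mul_pow]; norm_num
    _ ≤ (3 ^ 6) ^ ℓ := Nat.pow_le_pow_left (by norm_num) ℓ
    _ = _ := (pow_mul 3 6 ℓ).symm

theorem threshold_le {n ℓ : ℕ} (hn : 2 ≤ n) (hℓ : 0 < ℓ) :
    (1 / (n : ℝ)) ^ 3 ^ (6 * ℓ) ≤ 1 / 2 * ((1 / (n : ℝ)) ^ 4 ^ (ℓ + 2) / (4 * n ^ 2)) ^ ℓ := by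
  have hn' : (2 : ℝ) ≤ n := by exact_mod_cast hn
  have h1 : 1 / (n : ℝ) ≤ 1 := by rw [div_le_one (by positivity)]; linarith
  calc (1 / (n : ℝ)) ^ 3 ^ (6 * ℓ) ≤ (1 / (n : ℝ)) ^ (1 + (4 ^ (ℓ + 2) + 4) * ℓ) :=
        pow_le_pow_of_le_one (by positivity) h1 (exponent_le hℓ)
    _ = 1 / n * ((1 / (n : ℝ)) ^ 4 ^ (ℓ + 2) * (1 / n) ^ 4) ^ ℓ := by
        rw [pow_add, pow_one, pow_mul, pow_add]
    _ ≤ 1 / 2 * ((1 / (n : ℝ)) ^ 4 ^ (ℓ + 2) * (1 / (4 * n ^ 2))) ^ ℓ := by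
        have : (1 / (n : ℝ)) ^ 4 ≤ 1 / (4 * n ^ 2) := by
          rw [one_div_pow]
          refine one_div_le_one_div_of_le (by positivity) ?_
          have : (4 : ℝ) ≤ n ^ 2 := by nlinarith
          nlinarith
        gcongr
    _ = _ := by rw [mul_one_div]

theorem failure_le {n ℓ : ℕ} (hn : 2 ≤ n) {δ : ℝ} (hδ : 0 < δ) :
    (ℓ : ℝ) * ((1 / (n : ℝ)) ^ 4 ^ (ℓ + 2)) ^ (⌊δ * n / (2 * 4 ^ ℓ)⌋₊ + 1) ≤
      Real.exp (-δ * (n : ℝ) ^ ((1 : ℝ) / 3 ^ ℓ)) := by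
  have hn' : (2 : ℝ) ≤ n := by exact_mod_cast hn
  set u := δ * n / (2 * 4 ^ ℓ) with hu
  set a := ⌊u⌋₊ + 1 with ha
  have hau : u ≤ a := by
    have := Nat.lt_floor_add_one u
    push_cast [ha]
    exact this.le
  have ha1 : (1 : ℝ) ≤ a := by
    push_cast [ha]
    linarith [Nat.cast_nonneg (α := ℝ) ⌊u⌋₊]
  have hexp : 1 / (n : ℝ) ≤ Real.exp (-(1 / 2)) := by
    rw [Real.exp_neg, ← one_div]
    refine one_div_le_one_div_of_le (Real.exp_pos _) (le_trans ?_ hn')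
    rw [← Real.le_log_iff_exp_le (by norm_num)]
    linarith [Real.log_two_gt_d9]
  have hroot : (n : ℝ) ^ ((1 : ℝ) / 3 ^ ℓ) ≤ n := by
    have h3 : (1 : ℝ) ≤ 3 ^ ℓ := one_le_pow₀ (by norm_num)
    calc (n : ℝ) ^ ((1 : ℝ) / 3 ^ ℓ) ≤ (n : ℝ) ^ (1 : ℝ) :=
          Real.rpow_le_rpow_of_exponent_le (by linarith)
            ((div_le_one (by positivity)).2 h3)
      _ = n := Real.rpow_one _
  have h4u : 4 ^ ℓ * (2 * u) = δ * n := by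
    rw [hu]
    field_simp
  have hℓ : (ℓ : ℝ) ≤ Real.exp (4 ^ ℓ) := by
    have h1 : (ℓ : ℝ) ≤ 4 ^ ℓ := by exact_mod_cast (Nat.lt_pow_self (by norm_num)).le
    linarith [Real.add_one_le_exp ((4 : ℝ) ^ ℓ)]
  calc (ℓ : ℝ) * ((1 / (n : ℝ)) ^ 4 ^ (ℓ + 2)) ^ a
      ≤ Real.exp (4 ^ ℓ) * ((Real.exp (-(1 / 2))) ^ 4 ^ (ℓ + 2)) ^ a := by gcongr
    _ = Real.exp (4 ^ ℓ - 8 * 4 ^ ℓ * a) := by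
        rw [← Real.exp_nat_mul, ← Real.exp_nat_mul, ← Real.exp_add]
        congr 1
        push_cast
        ring
    _ ≤ Real.exp (-δ * (n : ℝ) ^ ((1 : ℝ) / 3 ^ ℓ)) := by
        refine Real.exp_le_exp.2 ?_
        have h4 : (0 : ℝ) < 4 ^ ℓ := by positivity
        have e1 := mul_le_mul_of_nonneg_left hau h4.le
        have e2 := mul_le_mul_of_nonneg_left ha1 h4.le
        have e3 := mul_le_mul_of_nonneg_left hroot hδ.le
        linarith

end Numerics

/-- if an r × n^ℓ matrix T has σ_{δn^ℓ}(T) ≥ η then for ρ-perturbations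
x̃^{(1)},…,x̃^{(ℓ)} of any vectors, ‖T(x̃^{(1)} ⊗ ⋯ ⊗ x̃^{(ℓ)})‖ ≥ η ρ^ℓ (1/n)^{3^{O(ℓ)}}
with probability ≥ 1 − exp(−δ n^{1/3^ℓ}).  The 3^{O(ℓ)} is formalized by an absolute
constant `c` with exponent 3^{c·ℓ}. -/
theorem perturbed_product_vector_anticoncentration :
    ∃ c : ℕ, 0 < c ∧
      ∀ (δ : ℝ), 0 < δ → δ < 1 →
      ∀ (ℓ n r : ℕ), 0 < n →
      ∀ (ρ η : ℝ), 0 < ρ →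
      ∀ (T : Matrix (Fin r) (Fin ℓ → Fin n) ℝ) (k : ℕ),
        (k : ℝ) = δ * (n : ℝ) ^ ℓ → η ≤ singVal T k →
        ∀ x : Fin ℓ → Fin n → ℝ,
          ENNReal.ofReal (1 - Real.exp (-δ * (n : ℝ) ^ ((1 : ℝ) / 3 ^ ℓ))) ≤
            (Measure.pi fun _ : Fin ℓ => gaussianVec n ρ)
              {g | η * ρ ^ ℓ * (1 / (n : ℝ)) ^ 3 ^ (c * ℓ) ≤
                enorm2 (T.mulVec fun f => ∏ t, (x t (f t) + g t (f t)))} := by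
  refine ⟨6, by norm_num, ?_⟩
  intro δ hδ hδ1 ℓ n r hn ρ η hρ T k hk hσ x
  rcases le_or_gt η 0 with hη | hη
  · have huniv : {g : Fin ℓ → Fin n → ℝ | η * ρ ^ ℓ * (1 / (n : ℝ)) ^ 3 ^ (6 * ℓ) ≤
        enorm2 (T.mulVec fun f => ∏ t, (x t (f t) + g t (f t)))} = Set.univ := by
      refine Set.eq_univ_of_forall fun g => ?_
      have h0 : η * ρ ^ ℓ * (1 / (n : ℝ)) ^ 3 ^ (6 * ℓ) ≤ 0 := by
        rw [mul_assoc]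
        exact mul_nonpos_of_nonpos_of_nonneg hη (by positivity)
      exact h0.trans (Real.sqrt_nonneg _)
    rw [huniv, measure_univ]
    exact ENNReal.ofReal_le_one.2 (by linarith [Real.exp_pos (-δ * (n : ℝ) ^ ((1 : ℝ) / 3 ^ ℓ))])
  have hne : n ^ ℓ ≠ 1 := fun h => by
    have h1 : (n : ℝ) ^ ℓ = 1 := by exact_mod_cast h
    rw [h1, mul_one] at hk
    rw [← hk] at hδ hδ1
    have h2 : 0 < k := by exact_mod_cast hδ
    have h3 : k < 1 := by exact_mod_cast hδ1
    omega
  have hℓ : 0 < ℓ := Nat.pos_of_ne_zero fun h => hne (by simp [h])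
  have hn2 : 2 ≤ n := by
    by_contra! h
    exact hne (by simp [show n = 1 by omega])
  obtain ⟨K, hKk, hK⟩ := exists_subspace_of_le_singVal T hη hσ
  set q : ℝ := (1 / (n : ℝ)) ^ 4 ^ (ℓ + 2) with hq
  have hfail := pi_norm_prodEval_lt_le hn hρ (q := q) (by positivity)
    (⌊δ * n / (2 * 4 ^ ℓ)⌋₊ + 1) ℓ (euclideanCol T) x K (δ := δ) (η := η / 2) hδ (by positivity)
    (by rw [hKk, hk])
    (by push_cast; gcongr; exact Nat.floor_le (by positivity)) hK
  set Fail := {g | ‖prodEval (euclideanCol T) (x + g)‖ <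
    η / 2 * (q * ρ / (4 * (n : ℝ) ^ 2)) ^ ℓ} with hFail
  have hsub : Failᶜ ⊆ {g : Fin ℓ → Fin n → ℝ | η * ρ ^ ℓ * (1 / (n : ℝ)) ^ 3 ^ (6 * ℓ) ≤
      enorm2 (T.mulVec fun f => ∏ t, (x t (f t) + g t (f t)))} := by
    intro g hg
    have hle : η / 2 * (q * ρ / (4 * (n : ℝ) ^ 2)) ^ ℓ ≤
        ‖prodEval (euclideanCol T) (x + g)‖ := not_lt.1 hg
    rw [prodEval, sum_smul_euclideanCol, ← enorm2_eq_norm] at hle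
    refine le_trans ?_ hle
    calc η * ρ ^ ℓ * (1 / (n : ℝ)) ^ 3 ^ (6 * ℓ)
        ≤ η * ρ ^ ℓ * (1 / 2 * (q / (4 * n ^ 2)) ^ ℓ) := by
          gcongr
          exact threshold_le hn2 hℓ
      _ = η / 2 * (q * ρ / (4 * (n : ℝ) ^ 2)) ^ ℓ := by
          rw [show q * ρ / (4 * (n : ℝ) ^ 2) = ρ * (q / (4 * n ^ 2)) by ring, mul_pow]
          ring
  have hfail' : (Measure.pi fun _ : Fin ℓ => gaussianVec n ρ) Fail ≤
      ENNReal.ofReal (Real.exp (-δ * (n : ℝ) ^ ((1 : ℝ) / 3 ^ ℓ))) := by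
    refine hfail.trans ?_
    rw [← ENNReal.ofReal_pow (by positivity), ← ENNReal.ofReal_natCast,
      ← ENNReal.ofReal_mul (by positivity)]
    exact ENNReal.ofReal_le_ofReal (failure_le hn2 hδ)
  refine le_trans ?_ (measure_mono hsub)
  rw [ENNReal.ofReal_sub _ (Real.exp_pos _).le, ENNReal.ofReal_one, tsub_le_iff_left,
    ← measure_univ (μ := Measure.pi fun _ : Fin ℓ => gaussianVec n ρ),
    ← Set.union_compl_self Fail]
  exact (measure_union_le _ _).trans (by gcongr)

end
end

section
/- For any matrix A with R columns A_1, A_2, ..., A_R, the leave-one-out distance ℓ(A) and the smallest singular value satisfy ℓ(A)/√R ≤ σ_min(A) ≤ ℓ(A). -/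
noncomputable section

/-- Euclidean distance from a vector to a subspace. -/
def distE {ι : Type*} [Fintype ι] (v : ι → ℝ) (W : Submodule ℝ (ι → ℝ)) : ℝ :=
  sInf {t : ℝ | ∃ w ∈ W, t = enorm2 (v - w)}

/-- Leave-one-out distance: the minimum over columns of the distance from that column
to the span of the other columns. -/
def looDist {ι : Type*} [Fintype ι] {R : ℕ} (A : Matrix ι (Fin R) ℝ) : ℝ :=
  sInf {t : ℝ | ∃ i : Fin R, t = distE (fun p => A p i)
    (Submodule.span ℝ {v : ι → ℝ | ∃ j : Fin R, j ≠ i ∧ v = fun p => A p j})}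

/-- Smallest singular value: the minimum of ‖Au‖₂ over unit vectors u. -/
def sigmaMin {ι : Type*} [Fintype ι] {R : ℕ} (A : Matrix ι (Fin R) ℝ) : ℝ :=
  sInf {t : ℝ | ∃ u : Fin R → ℝ, enorm2 u = 1 ∧ t = enorm2 (A.mulVec u)}

lemma enorm2_nonneg {ι : Type*} [Fintype ι] (x : ι → ℝ) : 0 ≤ enorm2 x :=
  Real.sqrt_nonneg _

lemma enorm2_smul {ι : Type*} [Fintype ι] (c : ℝ) (x : ι → ℝ) :
    enorm2 (c • x) = |c| * enorm2 x := by
  simp only [enorm2, Pi.smul_apply, smul_eq_mul, mul_pow, ← Finset.mul_sum]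
  rw [Real.sqrt_mul (sq_nonneg c), Real.sqrt_sq_eq_abs]

lemma abs_le_enorm2 {ι : Type*} [Fintype ι] (x : ι → ℝ) (i : ι) : |x i| ≤ enorm2 x := by
  rw [← Real.sqrt_sq_eq_abs]
  exact Real.sqrt_le_sqrt
    (Finset.single_le_sum (f := fun i => x i ^ 2) (fun j _ => sq_nonneg (x j)) (Finset.mem_univ i))

/-- Some coordinate of a unit vector in dimension `R` has modulus at least `1 / √R`. -/
lemma exists_inv_sqrt_le_abs {R : ℕ} (u : Fin R → ℝ) (hu : enorm2 u = 1) :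
    ∃ i, 1 / Real.sqrt R ≤ |u i| := by
  have hs : ∑ i, u i ^ 2 = 1 := by rwa [enorm2, Real.sqrt_eq_one] at hu
  have hR : 0 < R := by
    rcases Nat.eq_zero_or_pos R with rfl | h
    · simp at hs
    · exact h
  have hR' : (0 : ℝ) < R := by exact_mod_cast hR
  obtain ⟨i, -, hi⟩ := Finset.exists_le_of_sum_le (s := Finset.univ)
    (f := fun _ : Fin R => (1 : ℝ) / R) (g := fun i => u i ^ 2) ⟨⟨0, hR⟩, Finset.mem_univ _⟩
    (by simp [hs, hR'.ne'])
  refine ⟨i, ?_⟩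
  have h := Real.sqrt_le_sqrt hi
  rwa [Real.sqrt_sq_eq_abs, Real.sqrt_div zero_le_one, Real.sqrt_one] at h

lemma distE_nonneg {ι : Type*} [Fintype ι] (v : ι → ℝ) (W : Submodule ℝ (ι → ℝ)) :
    0 ≤ distE v W := by
  apply Real.sInf_nonneg
  rintro _ ⟨w, -, rfl⟩
  exact enorm2_nonneg _

lemma distE_le {ι : Type*} [Fintype ι] (v : ι → ℝ) {W : Submodule ℝ (ι → ℝ)} {w : ι → ℝ}
    (hw : w ∈ W) : distE v W ≤ enorm2 (v - w) :=
  csInf_le ⟨0, by rintro _ ⟨w, -, rfl⟩; exact enorm2_nonneg _⟩ ⟨w, hw, rfl⟩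

lemma looDist_nonneg {ι : Type*} [Fintype ι] {R : ℕ} (A : Matrix ι (Fin R) ℝ) :
    0 ≤ looDist A := by
  apply Real.sInf_nonneg
  rintro _ ⟨i, rfl⟩
  exact distE_nonneg _ _

lemma looDist_le {ι : Type*} [Fintype ι] {R : ℕ} (A : Matrix ι (Fin R) ℝ) (i : Fin R) :
    looDist A ≤ distE (fun p => A p i)
      (Submodule.span ℝ {v : ι → ℝ | ∃ j : Fin R, j ≠ i ∧ v = fun p => A p j}) :=
  csInf_le ⟨0, by rintro _ ⟨i, rfl⟩; exact distE_nonneg _ _⟩ ⟨i, rfl⟩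

lemma sigmaMin_le {ι : Type*} [Fintype ι] {R : ℕ} (A : Matrix ι (Fin R) ℝ) {u : Fin R → ℝ}
    (hu : 1 ≤ enorm2 u) : sigmaMin A ≤ enorm2 (A.mulVec u) := by
  have hpos : 0 < enorm2 u := zero_lt_one.trans_le hu
  have h : sigmaMin A ≤ enorm2 (A.mulVec ((enorm2 u)⁻¹ • u)) := by
    refine csInf_le ⟨0, by rintro _ ⟨u, -, rfl⟩; exact enorm2_nonneg _⟩ ⟨_, ?_, rfl⟩
    rw [enorm2_smul, abs_of_pos (inv_pos.mpr hpos), inv_mul_cancel₀ hpos.ne']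
  rw [Matrix.mulVec_smul, enorm2_smul, abs_of_pos (inv_pos.mpr hpos)] at h
  exact h.trans (mul_le_of_le_one_left (enorm2_nonneg _) (inv_le_one_of_one_le₀ hu))

/-- The span of the columns other than the `i`-th consists of the images of the vectors whose
`i`-th coordinate vanishes. -/
lemma mem_span_columns_ne_iff {ι : Type*} {R : ℕ} (A : Matrix ι (Fin R) ℝ) (i : Fin R)
    (w : ι → ℝ) :
    w ∈ Submodule.span ℝ {v : ι → ℝ | ∃ j : Fin R, j ≠ i ∧ v = fun p => A p j} ↔
      ∃ c : Fin R → ℝ, c i = 0 ∧ A.mulVec c = w := by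
  constructor
  · intro hw
    induction hw using Submodule.span_induction with
    | mem x hx =>
      obtain ⟨j, hj, rfl⟩ := hx
      exact ⟨Pi.single j 1, by simp [hj.symm], by ext p; simp⟩
    | zero => exact ⟨0, rfl, Matrix.mulVec_zero A⟩
    | add x y _ _ hx hy =>
      obtain ⟨c, hc, rfl⟩ := hx
      obtain ⟨d, hd, rfl⟩ := hy
      exact ⟨c + d, by simp [hc, hd], Matrix.mulVec_add A c d⟩
    | smul a x _ hx =>
      obtain ⟨c, hc, rfl⟩ := hx
      exact ⟨a • c, by simp [hc], Matrix.mulVec_smul A a c⟩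
  · rintro ⟨c, hc, rfl⟩
    have h : A.mulVec c = ∑ j, c j • fun p => A p j := by
      ext p
      simp [Matrix.mulVec, dotProduct, mul_comm]
    rw [h]
    refine Submodule.sum_mem _ fun j _ => ?_
    by_cases hj : j = i
    · subst hj
      simp [hc]
    · exact Submodule.smul_mem _ _ (Submodule.subset_span ⟨j, hj, rfl⟩)

lemma column_sub_mulVec {ι : Type*} {R : ℕ} (A : Matrix ι (Fin R) ℝ) (i : Fin R)
    (c : Fin R → ℝ) :
    (fun p => A p i) - A.mulVec c = A.mulVec (Pi.single i 1 - c) := by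
  rw [Matrix.mulVec_sub]
  congr 1
  ext p
  simp

/-- A vector with nonzero `i`-th coordinate `t` is mapped to a vector of norm at least
`|t|` times the leave-one-out distance. -/
lemma abs_mul_looDist_le {ι : Type*} [Fintype ι] {R : ℕ} (A : Matrix ι (Fin R) ℝ)
    (u : Fin R → ℝ) {i : Fin R} (hi : u i ≠ 0) :
    |u i| * looDist A ≤ enorm2 (A.mulVec u) := by
  have hu : u = u i • (Pi.single i 1 - (Pi.single i 1 - (u i)⁻¹ • u)) := by
    rw [sub_sub_cancel, smul_inv_smul₀ hi]
  have hd := (looDist_le A i).trans (distE_le (fun p => A p i)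
    ((mem_span_columns_ne_iff A i _).mpr
      ⟨Pi.single i 1 - (u i)⁻¹ • u, by simp [hi], rfl⟩))
  rw [column_sub_mulVec] at hd
  calc |u i| * looDist A ≤ _ := mul_le_mul_of_nonneg_left hd (abs_nonneg _)
    _ = enorm2 (A.mulVec u) := by rw [← enorm2_smul, ← Matrix.mulVec_smul, ← hu]

/-- ℓ(A)/√R ≤ σ_min(A) ≤ ℓ(A). -/
theorem leave_one_out_vs_sigma_min {n R : ℕ} (A : Matrix (Fin n) (Fin R) ℝ) :
    looDist A / Real.sqrt R ≤ sigmaMin A ∧ sigmaMin A ≤ looDist A := by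
  rcases Nat.eq_zero_or_pos R with rfl | hR
  · simp [looDist, sigmaMin, enorm2]
  have hR' : 0 < 1 / Real.sqrt R := by positivity
  constructor
  · refine le_csInf ⟨_, Pi.single ⟨0, hR⟩ 1, ?_, rfl⟩ ?_
    · simp [enorm2, Pi.single_apply]
    rintro _ ⟨u, hu, rfl⟩
    obtain ⟨i, hi⟩ := exists_inv_sqrt_le_abs u hu
    refine le_trans ?_ (abs_mul_looDist_le A u (abs_pos.mp (hR'.trans_le hi)))
    rw [div_eq_mul_one_div, mul_comm]
    exact mul_le_mul_of_nonneg_right hi (looDist_nonneg A)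
  · refine le_csInf ⟨_, ⟨0, hR⟩, rfl⟩ ?_
    rintro _ ⟨i, rfl⟩
    refine le_csInf ⟨_, 0, Submodule.zero_mem _, rfl⟩ ?_
    rintro _ ⟨w, hw, rfl⟩
    obtain ⟨c, hc, rfl⟩ := (mem_span_columns_ne_iff A i w).mp hw
    rw [column_sub_mulVec]
    refine sigmaMin_le A (le_trans ?_ (abs_le_enorm2 _ i))
    simp [hc]

end
end
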